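/- arXiv:2407.02015 — 15 statements merged into one kernel-verified Lean document; each statement's English description precedes it below -/
import Mathlib

section
/- Let Π ∈ ℝ^{M×N} be a positive coupling matrix. Then its H-matrix H(Π) is positive semidefinite, the vector q₀ = [1_M; −1_N] ∈ ℝ^{M+N} satisfies H(Π) q₀ = 0, and the kernel of H(Π) is exactly the one-dimensional span of q₀; equivalently, the smallest eigenvalue of H(Π) is zero and it is a simple eigenvalue with eigenvector q₀. -/
open Matrix

lemma quad_aux (M N : ℕ) (P : Matrix (Fin M) (Fin N) ℝ) (x : Fin M ⊕ Fin N → ℝ) :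
    x ⬝ᵥ ((Matrix.fromBlocks (Matrix.diagonal (P *ᵥ 1)) P Pᵀ
      (Matrix.diagonal (Pᵀ *ᵥ 1))) *ᵥ x)
      = ∑ i, ∑ j, P i j * (x (Sum.inl i) + x (Sum.inr j)) ^ 2 := by
  have e : ∀ i j, P i j * (x (Sum.inl i) + x (Sum.inr j)) ^ 2 =
      (x (Sum.inl i) * (P i j * x (Sum.inl i)) + x (Sum.inl i) * (P i j * x (Sum.inr j))) +
      (x (Sum.inr j) * (P i j * x (Sum.inl i)) + x (Sum.inr j) * (P i j * x (Sum.inr j))) := by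
    intro i j; ring
  simp only [e, Finset.sum_add_distrib]
  rw [Finset.sum_comm (f := fun i j => x (Sum.inr j) * (P i j * x (Sum.inl i))),
    Finset.sum_comm (f := fun i j => x (Sum.inr j) * (P i j * x (Sum.inr j)))]
  rw [Matrix.fromBlocks_mulVec]
  simp only [dotProduct, Fintype.sum_sum_type, Sum.elim_inl, Sum.elim_inr, Pi.add_apply,
    Matrix.mulVec_diagonal, mul_add, Finset.sum_add_distrib]
  simp only [Matrix.mulVec, dotProduct, Matrix.transpose_apply, Pi.one_apply, mul_one,
    Function.comp_apply, Finset.mul_sum, Finset.sum_mul]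

/-- For a positive coupling matrix `P`, its H-matrix is positive semidefinite,
`q₀ = [1_M; -1_N]` is in the kernel, and the kernel is exactly the span of `q₀`. -/
theorem stmt1 (M N : ℕ) (P : Matrix (Fin M) (Fin N) ℝ)
    (hpos : ∀ i j, 0 < P i j)
    (hsum : ∑ i, ∑ j, P i j = 1) :
    let H : Matrix (Fin M ⊕ Fin N) (Fin M ⊕ Fin N) ℝ :=
      Matrix.fromBlocks (Matrix.diagonal (P *ᵥ 1)) P Pᵀ (Matrix.diagonal (Pᵀ *ᵥ 1))
    let q₀ : Fin M ⊕ Fin N → ℝ := Sum.elim 1 (-1)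
    H.PosSemidef ∧ (H *ᵥ q₀ = 0) ∧
    (∀ x : Fin M ⊕ Fin N → ℝ, H *ᵥ x = 0 → ∃ c : ℝ, x = c • q₀) := by
  intro H q₀
  have hnn : ∀ (x : Fin M ⊕ Fin N → ℝ) i j,
      0 ≤ P i j * (x (Sum.inl i) + x (Sum.inr j)) ^ 2 :=
    fun x i j => mul_nonneg (hpos i j).le (sq_nonneg _)
  refine ⟨?_, ?_, ?_⟩
  · refine Matrix.PosSemidef.of_dotProduct_mulVec_nonneg ?_ ?_
    · refine Matrix.IsHermitian.fromBlocks ?_ ?_ ?_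
      · exact Matrix.isHermitian_diagonal _
      · exact Matrix.conjTranspose_eq_transpose_of_trivial P
      · exact Matrix.isHermitian_diagonal _
    · intro x
      rw [star_trivial, quad_aux]
      exact Finset.sum_nonneg fun i _ => Finset.sum_nonneg fun j _ => hnn x i j
  · ext k
    rcases k with i | j
    · simp [H, q₀, Matrix.fromBlocks_mulVec, Matrix.mulVec_diagonal, Matrix.mulVec_neg]
    · simp [H, q₀, Matrix.fromBlocks_mulVec, Matrix.mulVec_diagonal, Matrix.mulVec_neg]
  · intro x hx
    have h0 := quad_aux M N P x
    change x ⬝ᵥ (H *ᵥ x) = _ at h0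
    rw [hx, dotProduct_zero] at h0
    have key : ∀ i j, x (Sum.inl i) + x (Sum.inr j) = 0 := by
      intro i j
      have h1 := (Finset.sum_eq_zero_iff_of_nonneg
        (fun i _ => Finset.sum_nonneg fun j _ => hnn x i j)).1 h0.symm i (Finset.mem_univ _)
      have h2 := (Finset.sum_eq_zero_iff_of_nonneg
        (fun j _ => hnn x i j)).1 h1 j (Finset.mem_univ _)
      simpa [(hpos i j).ne'] using h2
    have hM : Nonempty (Fin M) := by
      by_contra h
      rw [not_nonempty_iff] at h
      simp at hsum
    have hN : Nonempty (Fin N) := by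
      by_contra h
      rw [not_nonempty_iff] at h
      simp at hsum
    obtain ⟨i0⟩ := hM
    obtain ⟨j0⟩ := hN
    refine ⟨x (Sum.inl i0), ?_⟩
    ext k
    rcases k with i | j
    · simp [q₀]; linarith [key i j0, key i0 j0]
    · simp [q₀]; linarith [key i0 j]
end

section
/- Let Π ∈ ℝ^{M×N} be a positive coupling matrix with marginals μ = Π 1_N and ν = Πᵀ 1_M, and let S = diag(ν) − Πᵀ diag(μ)^{-1} Π ∈ ℝ^{N×N}. Then the (N−1)×(N−1) matrix obtained from S by deleting its last row and last column is invertible. -/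
open Matrix

/-- For a positive coupling matrix `P`, the matrix `diag(ν) - Pᵀ diag(μ)⁻¹ P`
with its last row and column deleted is invertible. -/
theorem stmt2 (M N : ℕ) (P : Matrix (Fin M) (Fin (N + 1)) ℝ)
    (hpos : ∀ i j, 0 < P i j)
    (hsum : ∑ i, ∑ j, P i j = 1) :
    let μ : Fin M → ℝ := P *ᵥ 1
    let ν : Fin (N + 1) → ℝ := Pᵀ *ᵥ 1
    let S : Matrix (Fin (N + 1)) (Fin (N + 1)) ℝ :=
      Matrix.diagonal ν - Pᵀ * (Matrix.diagonal fun i => (μ i)⁻¹) * P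
    (S.submatrix (Fin.castSucc : Fin N → Fin (N + 1)) Fin.castSucc).det ≠ 0 := by
  intro μ ν S
  have hM : Nonempty (Fin M) := by
    by_contra h
    rw [not_nonempty_iff] at h
    simp at hsum
  have hμ : ∀ i, 0 < μ i := by
    intro i
    have h : μ i = ∑ j, P i j := by simp [μ, Matrix.mulVec, dotProduct]
    rw [h]
    exact Finset.sum_pos (fun j _ => hpos i j) Finset.univ_nonempty
  have hoff : ∀ j k, j ≠ k → S j k < 0 := by
    intro j k hjk
    have h : S j k = -∑ i, P i j * (μ i)⁻¹ * P i k := by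
      simp [S, Matrix.diagonal_apply_ne _ hjk, Matrix.mul_apply, Matrix.diagonal_apply]
    rw [h, neg_lt_zero]
    exact Finset.sum_pos (fun i _ => mul_pos (mul_pos (hpos i j) (inv_pos.2 (hμ i))) (hpos i k))
      Finset.univ_nonempty
  have hS : S *ᵥ 1 = 0 := by
    have h1 : (Matrix.diagonal fun i => (μ i)⁻¹) *ᵥ μ = 1 := by
      ext i
      simp [Matrix.mulVec_diagonal, inv_mul_cancel₀ (hμ i).ne']
    have h2 : Matrix.diagonal ν *ᵥ 1 = ν := by
      ext i
      simp [Matrix.mulVec_diagonal]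
    have h3 : (Pᵀ * (Matrix.diagonal fun i => (μ i)⁻¹) * P) *ᵥ 1 = ν := by
      rw [← Matrix.mulVec_mulVec, ← Matrix.mulVec_mulVec]
      change Pᵀ *ᵥ ((Matrix.diagonal fun i => (μ i)⁻¹) *ᵥ μ) = ν
      rw [h1]
    rw [Matrix.sub_mulVec, h2, h3, sub_self]
  refine Matrix.det_ne_zero_of_sum_row_pos ?_ ?_
  · intro j k hjk
    exact hoff _ _ (fun h => hjk (Fin.castSucc_injective _ h))
  · intro j
    have h : ∑ k, S j.castSucc k = 0 := by
      simpa [Matrix.mulVec, dotProduct] using congrFun hS j.castSucc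
    rw [Fin.sum_univ_castSucc] at h
    have h' := hoff j.castSucc (Fin.last N) (Fin.castSucc_lt_last j).ne
    simp only [Matrix.submatrix_apply]
    linarith
end

section
/- Fix an integer N ≥ 3 and ε > 0. Let y_j = (cos(2πj/N), sin(2πj/N)) ∈ ℝ² for j = 0,…,N−1, let C_{ij} = ‖y_i − y_j‖₂², let K_{ij} = exp(−C_{ij}/ε), and let s = Σ_{j=0}^{N−1} K_{0j}. Then the matrix Π* = K/(N s) has uniform marginals Π* 1_N = (1/N) 1_N and (Π*)ᵀ 1_N = (1/N) 1_N, and Π* is the unique minimizer of the entropic optimal transport objective F(Π) = Σ_{i,j} C_{ij} Π_{ij} + ε Σ_{i,j} Π_{ij} log(N² Π_{ij}) over the set of N×N matrices Π with nonnegative entries satisfying Π 1_N = (1/N) 1_N and Πᵀ 1_N = (1/N) 1_N (with the convention 0·log 0 = 0). -/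
open Matrix Real

lemma aux_cos (N : ℕ) [NeZero N] (i j : Fin N) :
    Real.cos (2 * π * (((j - i : Fin N) : ℕ) : ℝ) / (N : ℝ)) =
      Real.cos (2 * π * ((j : ℕ) : ℝ) / (N : ℝ) - 2 * π * ((i : ℕ) : ℝ) / (N : ℝ)) := by
  have hN : (N : ℝ) ≠ 0 := Nat.cast_ne_zero.mpr (NeZero.ne N)
  rw [Fin.sub_def]
  simp only
  have h := Nat.div_add_mod (N - (i : ℕ) + (j : ℕ)) N
  set q := (N - (i : ℕ) + (j : ℕ)) / N
  set r := (N - (i : ℕ) + (j : ℕ)) % N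
  have h2 : N * q + r + (i : ℕ) = N + (j : ℕ) := by
    have := i.2
    omega
  have h3 : (N : ℝ) * q + r + ((i : ℕ) : ℝ) = N + ((j : ℕ) : ℝ) := by exact_mod_cast h2
  rw [← Real.cos_add_int_mul_two_pi
    (2 * π * ((j : ℕ) : ℝ) / (N : ℝ) - 2 * π * ((i : ℕ) : ℝ) / (N : ℝ)) (1 - (q : ℤ))]
  · congr 1
    push_cast
    field_simp
    linear_combination h3

lemma aux_main {n : ℕ} (C P Q : Matrix (Fin n) (Fin n) ℝ) (ε c M : ℝ) (hε : 0 < ε) (hM : 0 < M)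
    (hP : ∀ i j, 0 < P i j) (hC : ∀ i j, C i j = ε * (c - Real.log (M * P i j)))
    (hQ : ∀ i j, 0 ≤ Q i j) (hP1 : ∑ i, ∑ j, P i j = 1) (hQ1 : ∑ i, ∑ j, Q i j = 1) :
    (∑ i, ∑ j, C i j * Q i j) + ε * ∑ i, ∑ j, Q i j * Real.log (M * Q i j) =
      ε * c + ε * ∑ i, ∑ j, P i j * InformationTheory.klFun (Q i j / P i j) := by
  have key : ∀ i j, C i j * Q i j + ε * (Q i j * Real.log (M * Q i j)) =
      ε * c * Q i j + ε * (P i j * InformationTheory.klFun (Q i j / P i j))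
        + ε * Q i j - ε * P i j := by
    intro i j
    have hp := hP i j
    rw [hC, InformationTheory.klFun]
    rcases (hQ i j).eq_or_lt with h | h
    · rw [← h]; simp
    · rw [Real.log_mul hM.ne' hp.ne', Real.log_mul hM.ne' h.ne', Real.log_div h.ne' hp.ne']
      field_simp
      ring
  have : ∑ i, ∑ j, (C i j * Q i j + ε * (Q i j * Real.log (M * Q i j))) =
      ∑ i, ∑ j, (ε * c * Q i j + ε * (P i j * InformationTheory.klFun (Q i j / P i j))
        + ε * Q i j - ε * P i j) := by simp only [key]
  simp only [Finset.sum_add_distrib, Finset.sum_sub_distrib, ← Finset.mul_sum, hP1, hQ1] at this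
  linarith

/-- For `N` equally spaced points on the unit circle, the normalized Gibbs kernel
`Π* = K/(N s)` has uniform marginals and is the unique minimizer of the entropic
optimal transport objective over couplings with uniform marginals. -/
theorem stmt3 (N : ℕ) (hN : 3 ≤ N) (ε : ℝ) (hε : 0 < ε) :
    let y : Fin N → Fin 2 → ℝ := fun j =>
      ![Real.cos (2 * π * ((j : ℕ) : ℝ) / (N : ℝ)), Real.sin (2 * π * ((j : ℕ) : ℝ) / (N : ℝ))]
    let C : Matrix (Fin N) (Fin N) ℝ := fun i j => ∑ s, (y i s - y j s) ^ 2
    let K : Matrix (Fin N) (Fin N) ℝ := fun i j => Real.exp (-C i j / ε)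
    let s : ℝ := ∑ j, K ⟨0, by omega⟩ j
    let Pstar : Matrix (Fin N) (Fin N) ℝ := fun i j => K i j / ((N : ℝ) * s)
    let F : Matrix (Fin N) (Fin N) ℝ → ℝ := fun Q =>
      (∑ i, ∑ j, C i j * Q i j) + ε * ∑ i, ∑ j, Q i j * Real.log ((N : ℝ) ^ 2 * Q i j)
    (Pstar *ᵥ 1 = fun _ => 1 / (N : ℝ)) ∧ (Pstarᵀ *ᵥ 1 = fun _ => 1 / (N : ℝ)) ∧
    ∀ Q : Matrix (Fin N) (Fin N) ℝ, (∀ i j, 0 ≤ Q i j) →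
      (Q *ᵥ 1 = fun _ => 1 / (N : ℝ)) → (Qᵀ *ᵥ 1 = fun _ => 1 / (N : ℝ)) →
      F Pstar ≤ F Q ∧ (F Q = F Pstar → Q = Pstar) := by
  intro y C K s Pstar F
  have : NeZero N := ⟨by omega⟩
  have hN0 : (0 : ℝ) < N := by exact_mod_cast (by omega : 0 < N)
  have hCc : ∀ i j, C i j = 2 - 2 * Real.cos (2 * π * (((j - i : Fin N) : ℕ) : ℝ) / (N : ℝ)) := by
    intro i j
    rw [aux_cos, Real.cos_sub]
    simp only [C, y, Fin.sum_univ_two, Matrix.cons_val_zero, Matrix.cons_val_one]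
    nlinarith [Real.sin_sq_add_cos_sq (2 * π * ((i : ℕ) : ℝ) / (N : ℝ)),
      Real.sin_sq_add_cos_sq (2 * π * ((j : ℕ) : ℝ) / (N : ℝ))]
  have hCsymm : ∀ i j, C i j = C j i := by
    intro i j
    simp only [C]
    exact Finset.sum_congr rfl fun t _ => by ring
  have hrow : ∀ i, ∑ j, K i j = s := by
    intro i
    have h : ∀ i, ∑ j, K i j = ∑ k : Fin N,
        Real.exp (-(2 - 2 * Real.cos (2 * π * ((k : ℕ) : ℝ) / (N : ℝ))) / ε) := by
      intro i
      rw [← Equiv.sum_comp (Equiv.subRight i) (fun k : Fin N =>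
        Real.exp (-(2 - 2 * Real.cos (2 * π * ((k : ℕ) : ℝ) / (N : ℝ))) / ε))]
      exact Finset.sum_congr rfl fun j _ => by simp only [K, hCc, Equiv.subRight_apply]
    rw [h i]
    exact (h _).symm
  have hKpos : ∀ i j, 0 < K i j := fun i j => Real.exp_pos _
  have hs : 0 < s := Finset.sum_pos (fun j _ => hKpos _ j) ⟨0, Finset.mem_univ _⟩
  have hPpos : ∀ i j, 0 < Pstar i j := fun i j => div_pos (hKpos i j) (mul_pos hN0 hs)
  have hPsymm : Pstarᵀ = Pstar := by
    ext i j
    rw [Matrix.transpose_apply]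
    simp only [Pstar, K]
    rw [hCsymm]
  have hPr : Pstar *ᵥ 1 = fun _ => 1 / (N : ℝ) := by
    ext i
    simp only [Matrix.mulVec, dotProduct, Pi.one_apply, mul_one, Pstar]
    rw [← Finset.sum_div, hrow]
    field_simp
  have htot : ∀ Q : Matrix (Fin N) (Fin N) ℝ, (Q *ᵥ 1 = fun _ => 1 / (N : ℝ)) →
      ∑ i, ∑ j, Q i j = 1 := by
    intro Q h
    have h' : ∀ i, ∑ j, Q i j = 1 / (N : ℝ) := by
      intro i
      have := congrFun h i
      simpa [Matrix.mulVec, dotProduct] using this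
    simp only [h']
    simp [hN0.ne']
  refine ⟨hPr, by rw [hPsymm]; exact hPr, ?_⟩
  intro Q hQ hQr _
  have hCl : ∀ i j, C i j = ε * (Real.log (N / s) - Real.log ((N : ℝ) ^ 2 * Pstar i j)) := by
    intro i j
    have h1 : (N : ℝ) ^ 2 * Pstar i j = N / s * K i j := by
      simp only [Pstar]
      field_simp
    rw [h1, Real.log_mul (div_pos hN0 hs).ne' (hKpos i j).ne']
    simp only [K, Real.log_exp]
    field_simp
    ring
  have hM : (0 : ℝ) < (N : ℝ) ^ 2 := by positivity
  have hFQ := aux_main C Pstar Q ε _ _ hε hM hPpos hCl hQ (htot _ hPr) (htot _ hQr)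
  have hFP := aux_main C Pstar Pstar ε _ _ hε hM hPpos hCl (fun i j => (hPpos i j).le)
    (htot _ hPr) (htot _ hPr)
  have hz : ∀ i j, Pstar i j * InformationTheory.klFun (Pstar i j / Pstar i j) = 0 := by
    intro i j
    rw [div_self (hPpos i j).ne']
    simp [InformationTheory.klFun]
  simp only [hz, Finset.sum_const_zero, mul_zero, add_zero] at hFP
  change F Q = _ at hFQ
  change F Pstar = _ at hFP
  have hnn : ∀ i j, 0 ≤ Pstar i j * InformationTheory.klFun (Q i j / Pstar i j) := fun i j =>
    mul_nonneg (hPpos i j).le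
      (InformationTheory.klFun_nonneg (div_nonneg (hQ i j) (hPpos i j).le))
  have hnn2 : ∀ i, 0 ≤ ∑ j, Pstar i j * InformationTheory.klFun (Q i j / Pstar i j) := fun i =>
    Finset.sum_nonneg fun j _ => hnn i j
  have hnn3 := Finset.sum_nonneg fun i (_ : i ∈ Finset.univ) => hnn2 i
  refine ⟨?_, ?_⟩
  · rw [hFQ, hFP]
    have := mul_nonneg hε.le hnn3
    linarith
  · intro h
    rw [hFQ, hFP] at h
    have h0 : ε * ∑ i, ∑ j, Pstar i j * InformationTheory.klFun (Q i j / Pstar i j) = 0 := by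
      linarith
    have h1 := (mul_eq_zero.mp h0).resolve_left hε.ne'
    ext i j
    have h2 := (Finset.sum_eq_zero_iff_of_nonneg fun i _ => hnn2 i).mp h1 i (Finset.mem_univ i)
    have h3 := (Finset.sum_eq_zero_iff_of_nonneg fun j _ => hnn i j).mp h2 j (Finset.mem_univ j)
    have h4 := (mul_eq_zero.mp h3).resolve_left (hPpos i j).ne'
    rw [InformationTheory.klFun_eq_zero_iff (div_nonneg (hQ i j) (hPpos i j).le)] at h4
    exact (div_eq_one_iff_eq (hPpos i j).ne').mp h4
end

section
/- In the dual-potential setup, for every Y in the open set U and every 1 ≤ k ≤ M, the function Y ↦ OT_ε(Y) = μᵀ f(Y) + νᵀ g(Y) is differentiable with respect to y_k at Y, and its partial gradient is ∂OT_ε/∂y_k (Y) = Σ_{j=1}^{N} Π_{kj}(Y) · ∇_y c(y_k, y*_j), where ∇_y c denotes the gradient of c with respect to its first argument. -/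
open Matrix

/-- Danskin-type formula: in the dual-potential setup, the entropic OT dual value
`OT_ε(Y) = μᵀ f(Y) + νᵀ g(Y)` is differentiable in each source point `y_k`, with
partial gradient `Σ_j Π_{kj}(Y) ∇_y c(y_k, y*_j)`. -/
theorem stmt4 (ε : ℝ) (hε : 0 < ε) (M N d : ℕ) (hM : 1 ≤ M) (hN : 1 ≤ N) (hd : 1 ≤ d)
    (ystar : Fin N → EuclideanSpace ℝ (Fin d))
    (c : EuclideanSpace ℝ (Fin d) → EuclideanSpace ℝ (Fin d) → ℝ)
    (hc : ContDiff ℝ 2 (fun p : EuclideanSpace ℝ (Fin d) × EuclideanSpace ℝ (Fin d) =>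
      c p.1 p.2))
    (μ : Fin M → ℝ) (ν : Fin N → ℝ)
    (hμ : ∀ i, 0 < μ i) (hν : ∀ j, 0 < ν j)
    (hμ1 : ∑ i, μ i = 1) (hν1 : ∑ j, ν j = 1)
    (U : Set (Fin M → EuclideanSpace ℝ (Fin d))) (hU : IsOpen U)
    (f : (Fin M → EuclideanSpace ℝ (Fin d)) → Fin M → ℝ)
    (g : (Fin M → EuclideanSpace ℝ (Fin d)) → Fin N → ℝ)
    (hf : DifferentiableOn ℝ f U) (hg : DifferentiableOn ℝ g U)
    (Pmat : (Fin M → EuclideanSpace ℝ (Fin d)) → Matrix (Fin M) (Fin N) ℝ)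
    (hPmat : ∀ Y i j, Pmat Y i j =
      μ i * ν j * Real.exp ((-(c (Y i) (ystar j)) + f Y i + g Y j) / ε))
    (hrowm : ∀ Y ∈ U, ∀ i, ∑ j, Pmat Y i j = μ i)
    (hcolm : ∀ Y ∈ U, ∀ j, ∑ i, Pmat Y i j = ν j)
    (OTe : (Fin M → EuclideanSpace ℝ (Fin d)) → ℝ)
    (hOT : ∀ Y, OTe Y = (∑ i, μ i * f Y i) + ∑ j, ν j * g Y j) :
    ∀ Y ∈ U, ∀ k : Fin M,
      HasGradientAt (fun z => OTe (Function.update Y k z))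
        (∑ j, Pmat Y k j • gradient (fun y => c y (ystar j)) (Y k)) (Y k) := by
  intro Y hY k
  have hupd : HasFDerivAt (fun z => Function.update Y k z) _ (Y k) := hasFDerivAt_update (𝕜 := ℝ) Y (Y k)
  have hYk : Function.update Y k (Y k) = Y := Function.update_eq_self k Y
  have hdu : DifferentiableAt ℝ (fun z => Function.update Y k z) (Y k) := hupd.differentiableAt
  have hfd : DifferentiableAt ℝ (fun z => f (Function.update Y k z)) (Y k) := by
    refine DifferentiableAt.comp (g := f) (Y k) ?_ hdu
    rw [hYk]
    exact hf.differentiableAt (hU.mem_nhds hY)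
  have hgd : DifferentiableAt ℝ (fun z => g (Function.update Y k z)) (Y k) := by
    refine DifferentiableAt.comp (g := g) (Y k) ?_ hdu
    rw [hYk]
    exact hg.differentiableAt (hU.mem_nhds hY)
  have hF : ∀ i, ∃ L, HasFDerivAt (fun z => f (Function.update Y k z) i) L (Y k) := fun i =>
    ⟨_, ((differentiableAt_pi.1 hfd) i).hasFDerivAt⟩
  have hG : ∀ j, ∃ L, HasFDerivAt (fun z => g (Function.update Y k z) j) L (Y k) := fun j =>
    ⟨_, ((differentiableAt_pi.1 hgd) j).hasFDerivAt⟩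
  choose F hF using hF
  choose G hG using hG
  have hcd : ∀ j, DifferentiableAt ℝ (fun y => c y (ystar j)) (Y k) := by
    intro j
    have h1 : Differentiable ℝ (fun p : EuclideanSpace ℝ (Fin d) × EuclideanSpace ℝ (Fin d) =>
      c p.1 p.2) := hc.differentiable (by norm_num)
    exact (h1.comp (differentiable_id.prodMk (differentiable_const (ystar j)))).differentiableAt
  set C : Fin N → (EuclideanSpace ℝ (Fin d) →L[ℝ] ℝ) :=
    fun j => fderiv ℝ (fun y => c y (ystar j)) (Y k) with hC
  have hD : ∀ i j, HasFDerivAt (fun z => c (Function.update Y k z i) (ystar j))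
      (if i = k then C j else 0) (Y k) := by
    intro i j
    by_cases h : i = k
    · subst h
      simpa using (hcd j).hasFDerivAt
    · simpa [h] using hasFDerivAt_const (c (Y i) (ystar j)) (Y k)
  have hP : ∀ i j, HasFDerivAt (fun z => Pmat (Function.update Y k z) i j)
      ((Pmat Y i j * ε⁻¹) • (-(if i = k then C j else 0) + F i + G j)) (Y k) := by
    intro i j
    simp only [hPmat]
    have h := (((((hD i j).neg.add (hF i)).add (hG j)).mul_const ε⁻¹).exp).const_mul (μ i * ν j)
    simp only [div_eq_mul_inv]
    refine h.congr_fderiv ?_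
    simp only [hYk, Pi.add_apply, Pi.neg_apply, smul_smul, mul_assoc]
  have hS : HasFDerivAt (fun z => ∑ i, ∑ j, Pmat (Function.update Y k z) i j)
      (∑ i, ∑ j, (Pmat Y i j * ε⁻¹) • (-(if i = k then C j else 0) + F i + G j)) (Y k) :=
    HasFDerivAt.fun_sum fun i _ => HasFDerivAt.fun_sum fun j _ => hP i j
  have hev : ∀ᶠ z in nhds (Y k), Function.update Y k z ∈ U :=
    hdu.continuousAt.eventually (by beta_reduce; rw [hYk]; exact hU.mem_nhds hY)
  have hS0 : HasFDerivAt (fun z => ∑ i, ∑ j, Pmat (Function.update Y k z) i j)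
      (0 : EuclideanSpace ℝ (Fin d) →L[ℝ] ℝ) (Y k) := by
    refine (hasFDerivAt_const (1 : ℝ) (Y k)).congr_of_eventuallyEq ?_
    filter_upwards [hev] with z hz
    simp [hrowm _ hz, hμ1]
  have key := hS.unique hS0
  rw [hasGradientAt_iff_hasFDerivAt]
  simp only [hOT]
  have hO : HasFDerivAt (fun z => (∑ i, μ i * f (Function.update Y k z) i)
      + ∑ j, ν j * g (Function.update Y k z) j) ((∑ i, μ i • F i) + ∑ j, ν j • G j) (Y k) :=
    (HasFDerivAt.fun_sum fun i _ => (hF i).const_mul (μ i)).add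
      (HasFDerivAt.fun_sum fun j _ => (hG j).const_mul (ν j))
  refine hO.congr_fderiv ?_
  have hT : (InnerProductSpace.toDual ℝ (EuclideanSpace ℝ (Fin d)))
      (∑ j, Pmat Y k j • gradient (fun y => c y (ystar j)) (Y k)) = ∑ j, Pmat Y k j • C j := by
    simp [map_sum, gradient, hC]
  rw [hT]
  ext v
  have kv := congrArg (fun L : EuclideanSpace ℝ (Fin d) →L[ℝ] ℝ => L v) key
  have hite : ∀ i j, (if i = k then C j else 0) v = if i = k then C j v else 0 := by
    intro i j; split_ifs <;> simp
  simp only [_root_.sum_apply, _root_.add_apply, _root_.smul_apply, _root_.neg_apply,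
    _root_.zero_apply, smul_eq_mul, hite] at kv ⊢
  have e1 : ∑ i, μ i * F i v = ∑ i, ∑ j, Pmat Y i j * F i v := by
    simp only [← Finset.sum_mul, hrowm Y hY]
  have e2 : ∑ j, ν j * G j v = ∑ i, ∑ j, Pmat Y i j * G j v := by
    rw [Finset.sum_comm]
    simp only [← Finset.sum_mul, hcolm Y hY]
  have e3 : ∑ j, Pmat Y k j * C j v
      = ∑ i, ∑ j, Pmat Y i j * (if i = k then C j v else 0) := by
    rw [Finset.sum_comm]
    simp
  have e4 : ∑ i, ∑ j, Pmat Y i j * ε⁻¹ * (-(if i = k then C j v else 0) + F i v + G j v)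
      = ε⁻¹ * (∑ i, ∑ j, Pmat Y i j * F i v + ∑ i, ∑ j, Pmat Y i j * G j v
        - ∑ i, ∑ j, Pmat Y i j * (if i = k then C j v else 0)) := by
    simp only [← Finset.sum_add_distrib, ← Finset.sum_sub_distrib, Finset.mul_sum]
    refine Finset.sum_congr rfl fun i _ => Finset.sum_congr rfl fun j _ => ?_
    ring
  rw [e4] at kv
  rw [e1, e2, e3]
  have := (mul_eq_zero.1 kv).resolve_left (inv_ne_zero hε.ne')
  linarith
end

section
/- In the dual-potential setup, for every Y ∈ U and every 1 ≤ k ≤ M, the stacked Jacobian V_k(Y) = [∂f/∂y_k; ∂g/∂y_k] ∈ ℝ^{(M+N)×d} (whose rows are the gradients of the entries of f and g with respect to y_k) satisfies the linear system H(Π(Y)) · V_k(Y) = R_k(Y), where H(Π) = [[diag(Π 1_N), Π], [Πᵀ, diag(Πᵀ 1_M)]], R_k(Y) = [e_k (B_k 1_N)ᵀ; B_kᵀ] ∈ ℝ^{(M+N)×d}, e_k is the k-th standard basis vector of ℝ^M, and B_k(Y) ∈ ℝ^{d×N} has entries (B_k)_{sj} = (∂c/∂(y)_s)(y_k, y*_j)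 · Π_{kj}(Y). -/
open Matrix

/-- In the dual-potential setup, the stacked Jacobian `V_k = [∂f/∂y_k; ∂g/∂y_k]`
satisfies the linear system `H(Π(Y)) V_k = R_k`, where `R_k = [e_k (B_k 1)ᵀ; B_kᵀ]`
and `(B_k)_{sj} = ∂c/∂(y)_s (y_k, y*_j) · Π_{kj}(Y)`. -/
theorem stmt5 (ε : ℝ) (hε : 0 < ε) (M N d : ℕ) (hM : 1 ≤ M) (hN : 1 ≤ N) (hd : 1 ≤ d)
    (ystar : Fin N → EuclideanSpace ℝ (Fin d))
    (c : EuclideanSpace ℝ (Fin d) → EuclideanSpace ℝ (Fin d) → ℝ)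
    (hc : ContDiff ℝ 2 (fun p : EuclideanSpace ℝ (Fin d) × EuclideanSpace ℝ (Fin d) =>
      c p.1 p.2))
    (μ : Fin M → ℝ) (ν : Fin N → ℝ)
    (hμ : ∀ i, 0 < μ i) (hν : ∀ j, 0 < ν j)
    (hμ1 : ∑ i, μ i = 1) (hν1 : ∑ j, ν j = 1)
    (U : Set (Fin M → EuclideanSpace ℝ (Fin d))) (hU : IsOpen U)
    (f : (Fin M → EuclideanSpace ℝ (Fin d)) → Fin M → ℝ)
    (g : (Fin M → EuclideanSpace ℝ (Fin d)) → Fin N → ℝ)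
    (hf : DifferentiableOn ℝ f U) (hg : DifferentiableOn ℝ g U)
    (Pmat : (Fin M → EuclideanSpace ℝ (Fin d)) → Matrix (Fin M) (Fin N) ℝ)
    (hPmat : ∀ Y i j, Pmat Y i j =
      μ i * ν j * Real.exp ((-(c (Y i) (ystar j)) + f Y i + g Y j) / ε))
    (hrowm : ∀ Y ∈ U, ∀ i, ∑ j, Pmat Y i j = μ i)
    (hcolm : ∀ Y ∈ U, ∀ j, ∑ i, Pmat Y i j = ν j) :
    ∀ Y ∈ U, ∀ k : Fin M,
      let B : Matrix (Fin d) (Fin N) ℝ := fun s j =>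
        (fderiv ℝ (fun y => c y (ystar j)) (Y k)) (EuclideanSpace.single s 1) * Pmat Y k j
      let V : Matrix (Fin M ⊕ Fin N) (Fin d) ℝ := fun α t =>
        Sum.elim
          (fun i => (fderiv ℝ (fun z => f (Function.update Y k z) i) (Y k))
            (EuclideanSpace.single t 1))
          (fun j => (fderiv ℝ (fun z => g (Function.update Y k z) j) (Y k))
            (EuclideanSpace.single t 1)) α
      let R : Matrix (Fin M ⊕ Fin N) (Fin d) ℝ := fun α t =>
        Sum.elim (fun i => if i = k then ∑ j, B t j else 0) (fun j => B t j) α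
      let H : Matrix (Fin M ⊕ Fin N) (Fin M ⊕ Fin N) ℝ :=
        Matrix.fromBlocks (Matrix.diagonal (Pmat Y *ᵥ 1)) (Pmat Y) (Pmat Y)ᵀ
          (Matrix.diagonal ((Pmat Y)ᵀ *ᵥ 1))
      H * V = R := by
  intro Y hY k B V R H
  have hupd : DifferentiableAt ℝ (fun z => Function.update Y k z) (Y k) :=
    (hasFDerivAt_update (𝕜 := ℝ) Y (i := k) (Y k)).differentiableAt
  have hYk : Function.update Y k (Y k) = Y := Function.update_eq_self k Y
  have hUn : ∀ᶠ z in nhds (Y k), Function.update Y k z ∈ U := by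
    apply hupd.continuousAt.eventually
    simp only [hYk]
    exact hU.mem_nhds hY
  have hfd : DifferentiableAt ℝ f (Function.update Y k (Y k)) := by
    rw [hYk]; exact hf.differentiableAt (hU.mem_nhds hY)
  have hgd : DifferentiableAt ℝ g (Function.update Y k (Y k)) := by
    rw [hYk]; exact hg.differentiableAt (hU.mem_nhds hY)
  have hF : ∀ i, DifferentiableAt ℝ (fun z => f (Function.update Y k z) i) (Y k) := fun i =>
    differentiableAt_pi.1 (DifferentiableAt.comp (Y k) hfd hupd) i
  have hG : ∀ j, DifferentiableAt ℝ (fun z => g (Function.update Y k z) j) (Y k) := fun j =>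
    differentiableAt_pi.1 (DifferentiableAt.comp (Y k) hgd hupd) j
  have hC : ∀ j, DifferentiableAt ℝ (fun y => c y (ystar j)) (Y k) := fun j => by
    have h1 : Differentiable ℝ (fun p : EuclideanSpace ℝ (Fin d) × EuclideanSpace ℝ (Fin d) =>
      c p.1 p.2) := hc.differentiable (by norm_num)
    have h2 : DifferentiableAt ℝ (fun y : EuclideanSpace ℝ (Fin d) => (y, ystar j)) (Y k) := by
      fun_prop
    exact DifferentiableAt.comp (Y k) (h1 (Y k, ystar j)) h2
  have hCC : ∀ i j, HasFDerivAt (fun z => c (Function.update Y k z i) (ystar j))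
      (if i = k then fderiv ℝ (fun y => c y (ystar j)) (Y k) else 0) (Y k) := by
    intro i j
    by_cases h : i = k
    · subst h
      simpa using (hC j).hasFDerivAt
    · simpa [h] using hasFDerivAt_const (c (Y i) (ystar j)) (Y k)
  have hP : ∀ i j, HasFDerivAt (fun z => Pmat (Function.update Y k z) i j)
      ((Pmat Y i j / ε) • (-(if i = k then fderiv ℝ (fun y => c y (ystar j)) (Y k) else 0)
        + fderiv ℝ (fun z => f (Function.update Y k z) i) (Y k)
        + fderiv ℝ (fun z => g (Function.update Y k z) j) (Y k))) (Y k) := by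
    intro i j
    have h := (((((hCC i j).neg.add (hF i).hasFDerivAt).add (hG j).hasFDerivAt).mul_const
      ε⁻¹).exp).const_mul (μ i * ν j)
    simp only [hPmat, div_eq_mul_inv]
    refine HasFDerivAt.congr_fderiv h ?_
    simp only [Pi.add_apply, Pi.neg_apply, hYk, smul_smul]
    congr 1
    ring
  have key : ∀ (t : Fin d) (i : Fin M) (j : Fin N),
      (Pmat Y i j / ε) * (-(if i = k then
        fderiv ℝ (fun y => c y (ystar j)) (Y k) (EuclideanSpace.single t 1) else 0)
        + V (Sum.inl i) t + V (Sum.inr j) t) =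
      ((Pmat Y i j / ε) • (-(if i = k then fderiv ℝ (fun y => c y (ystar j)) (Y k) else 0)
        + fderiv ℝ (fun z => f (Function.update Y k z) i) (Y k)
        + fderiv ℝ (fun z => g (Function.update Y k z) j) (Y k)))
          (EuclideanSpace.single t 1) := by
    intro t i j
    by_cases h : i = k <;> simp [h, V] <;> ring
  have hrow : ∀ t i, ∑ j, (Pmat Y i j / ε) * (-(if i = k then
        fderiv ℝ (fun y => c y (ystar j)) (Y k) (EuclideanSpace.single t 1) else 0)
        + V (Sum.inl i) t + V (Sum.inr j) t) = 0 := by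
    intro t i
    have h1 := HasFDerivAt.fun_sum (u := Finset.univ) (fun j _ => hP i j)
    have h2 : HasFDerivAt (fun z => ∑ j, Pmat (Function.update Y k z) i j)
        (0 : EuclideanSpace ℝ (Fin d) →L[ℝ] ℝ) (Y k) :=
      (hasFDerivAt_const (μ i) (Y k)).congr_of_eventuallyEq
        (hUn.mono fun z hz => hrowm _ hz i)
    have h3 := congrArg (fun L => L (EuclideanSpace.single t 1)) (h1.unique h2)
    simp only [key]
    simpa only [_root_.sum_apply, _root_.zero_apply] using h3
  have hcol : ∀ t j, ∑ i, (Pmat Y i j / ε) * (-(if i = k then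
        fderiv ℝ (fun y => c y (ystar j)) (Y k) (EuclideanSpace.single t 1) else 0)
        + V (Sum.inl i) t + V (Sum.inr j) t) = 0 := by
    intro t j
    have h1 := HasFDerivAt.fun_sum (u := Finset.univ) (fun i _ => hP i j)
    have h2 : HasFDerivAt (fun z => ∑ i, Pmat (Function.update Y k z) i j)
        (0 : EuclideanSpace ℝ (Fin d) →L[ℝ] ℝ) (Y k) :=
      (hasFDerivAt_const (ν j) (Y k)).congr_of_eventuallyEq
        (hUn.mono fun z hz => hcolm _ hz j)
    have h3 := congrArg (fun L => L (EuclideanSpace.single t 1)) (h1.unique h2)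
    simp only [key]
    simpa only [_root_.sum_apply, _root_.zero_apply] using h3
  have hε0 : ε ≠ 0 := hε.ne'
  ext α t
  rw [Matrix.mul_apply, Fintype.sum_sum_type]
  rcases α with i | j
  · have h := congrArg (fun x => ε * x) (hrow t i)
    simp only [Finset.mul_sum, mul_zero] at h
    have hR : R (Sum.inl i) t = ∑ j, Pmat Y i j * (if i = k then
        fderiv ℝ (fun y => c y (ystar j)) (Y k) (EuclideanSpace.single t 1) else 0) := by
      by_cases hik : i = k
      · subst hik
        simp [R, B, mul_comm]
      · simp [R, hik]
    rw [hR, ← sub_eq_zero]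
    refine Eq.trans ?_ h
    simp only [H, Matrix.fromBlocks_apply₁₁, Matrix.fromBlocks_apply₁₂, Matrix.diagonal_apply,
      ite_mul, zero_mul, Finset.sum_ite_eq, Finset.mem_univ, if_true, Matrix.mulVec,
      dotProduct, Pi.one_apply, mul_one, Finset.sum_mul]
    rw [← Finset.sum_add_distrib, ← Finset.sum_sub_distrib]
    refine Finset.sum_congr rfl fun j _ => ?_
    field_simp
    ring
  · have h := congrArg (fun x => ε * x) (hcol t j)
    simp only [Finset.mul_sum, mul_zero] at h
    have hR : R (Sum.inr j) t = ∑ i, Pmat Y i j * (if i = k then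
        fderiv ℝ (fun y => c y (ystar j)) (Y k) (EuclideanSpace.single t 1) else 0) := by
      simp [R, B, mul_comm]
    rw [hR, ← sub_eq_zero]
    refine Eq.trans ?_ h
    simp only [H, Matrix.fromBlocks_apply₂₁, Matrix.fromBlocks_apply₂₂, Matrix.diagonal_apply,
      ite_mul, zero_mul, Finset.sum_ite_eq, Finset.mem_univ, if_true, Matrix.mulVec,
      dotProduct, Pi.one_apply, mul_one, Finset.sum_mul, Matrix.transpose_apply]
    rw [← Finset.sum_add_distrib, ← Finset.sum_sub_distrib]
    refine Finset.sum_congr rfl fun i _ => ?_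
    field_simp
    ring
end

section
/- In the dual-potential setup, define the Sinkhorn distance S(Y) = Σ_{i,j} C_{ij}(Y) Π_{ij}(Y), and for Y ∈ U set a_i(Y) = Σ_{j=1}^N C_{ij}(Y) Π_{ij}(Y) and b_j(Y) = Σ_{i=1}^M C_{ij}(Y) Π_{ij}(Y). Suppose r(Y) ∈ ℝ^{M+N} solves H(Π(Y)) r(Y) = [a(Y); b(Y)]. Then for every 1 ≤ k ≤ M, the partial gradient of S with respect to y_k is ∂S/∂y_k (Y) = Σ_{j=1}^N (1 − C_{kj}(Y)/ε) Π_{kj}(Y) ∇_y c(y_k, y*_j) + (1/ε) R_k(Y)ᵀ r(Y), where R_k(Y) = [e_k (B_k 1_N)ᵀ; B_kᵀ] ∈ ℝ^{(M+N)×d} and B_k(Y) ∈ ℝ^{d×N} has entries (B_k)_{sj} = (∂c/∂(y)_s)(y_k, y*_j) · Π_{kj}(Y). -/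
open Matrix

lemma sinkhorn_alg {M N : ℕ} (ε : ℝ) (hε : 0 < ε) (k : Fin M) (P C : Fin M → Fin N → ℝ)
    (u : Fin M → ℝ) (w x : Fin N → ℝ) (p : Fin M → ℝ) (q : Fin N → ℝ)
    (row : ∀ i, ∑ j, P i j * ((-(if i = k then x j else 0) + u i + w j) / ε) = 0)
    (col : ∀ j, ∑ i, P i j * ((-(if i = k then x j else 0) + u i + w j) / ε) = 0)
    (ha : ∀ i, (∑ j, P i j) * p i + ∑ j, P i j * q j = ∑ j, C i j * P i j)
    (hb : ∀ j, ∑ i, P i j * p i + (∑ i, P i j) * q j = ∑ i, C i j * P i j) :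
    ∑ i, ∑ j, (C i j * (P i j * ((-(if i = k then x j else 0) + u i + w j) / ε))
      + P i j * (if i = k then x j else 0))
    = ∑ j, (1 - C k j / ε) * P k j * x j
      + (1 / ε) * ((∑ j, x j * P k j) * p k + ∑ j, x j * P k j * q j) := by
  have e0 : ε ≠ 0 := hε.ne'
  -- everything as double sums
  have row2 : ∑ i, ∑ j, p i * (P i j * ((-(if i = k then x j else 0) + u i + w j) / ε)) = 0 := by
    simp_rw [← Finset.mul_sum, row]; simp
  have col2 : ∑ i, ∑ j, q j * (P i j * ((-(if i = k then x j else 0) + u i + w j) / ε)) = 0 := by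
    rw [Finset.sum_comm]; simp_rw [← Finset.mul_sum, col]; simp
  have ha2 : ∑ i, ∑ j, (u i / ε) * (P i j * p i + P i j * q j - C i j * P i j) = 0 := by
    apply Finset.sum_eq_zero; intro i _
    rw [← Finset.mul_sum, Finset.sum_sub_distrib, Finset.sum_add_distrib, ← Finset.sum_mul, ha i]
    ring
  have hb2 : ∑ i, ∑ j, (w j / ε) * (P i j * p i + P i j * q j - C i j * P i j) = 0 := by
    rw [Finset.sum_comm]
    apply Finset.sum_eq_zero; intro j _
    rw [← Finset.mul_sum, Finset.sum_sub_distrib, Finset.sum_add_distrib, ← Finset.sum_mul, hb j]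
    ring
  have rhs : ∑ j, (1 - C k j / ε) * P k j * x j
      + (1 / ε) * ((∑ j, x j * P k j) * p k + ∑ j, x j * P k j * q j)
      = ∑ i, ∑ j, (if i = k then x j else 0) *
        ((1 - C i j / ε) * P i j + (1 / ε) * (P i j * p i + P i j * q j)) := by
    rw [Finset.sum_eq_single k]
    · rw [Finset.sum_mul, ← Finset.sum_add_distrib, Finset.mul_sum, ← Finset.sum_add_distrib]
      apply Finset.sum_congr rfl; intro j _
      simp only [if_true]; ring
    · intro i _ hi; simp [hi]
    · simp
  rw [rhs, ← sub_eq_zero]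
  have key := congrArg₂ (· - ·) (congrArg₂ (· - ·) (congrArg₂ (· + ·) row2 col2) ha2) hb2
  simp only [add_zero, sub_zero] at key
  refine Eq.trans ?_ key
  clear key row2 col2 ha2 hb2
  simp only [← Finset.sum_add_distrib, ← Finset.sum_sub_distrib]
  apply Finset.sum_congr rfl; intro i _
  apply Finset.sum_congr rfl; intro j _
  generalize (if i = k then x j else 0) = t
  field_simp
  ring

/-- Gradient of the Sinkhorn distance `S(Y) = Σ_{ij} C_{ij}(Y) Π_{ij}(Y)` with
respect to `y_k`: if `r` solves `H(Π(Y)) r = [a; b]`, then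
`∂S/∂y_k = Σ_j (1 - C_{kj}/ε) Π_{kj} ∇_y c(y_k, y*_j) + (1/ε) R_kᵀ r`. -/
theorem stmt6 (ε : ℝ) (hε : 0 < ε) (M N d : ℕ) (hM : 1 ≤ M) (hN : 1 ≤ N) (hd : 1 ≤ d)
    (ystar : Fin N → EuclideanSpace ℝ (Fin d))
    (c : EuclideanSpace ℝ (Fin d) → EuclideanSpace ℝ (Fin d) → ℝ)
    (hc : ContDiff ℝ 2 (fun p : EuclideanSpace ℝ (Fin d) × EuclideanSpace ℝ (Fin d) =>
      c p.1 p.2))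
    (μ : Fin M → ℝ) (ν : Fin N → ℝ)
    (hμ : ∀ i, 0 < μ i) (hν : ∀ j, 0 < ν j)
    (hμ1 : ∑ i, μ i = 1) (hν1 : ∑ j, ν j = 1)
    (U : Set (Fin M → EuclideanSpace ℝ (Fin d))) (hU : IsOpen U)
    (f : (Fin M → EuclideanSpace ℝ (Fin d)) → Fin M → ℝ)
    (g : (Fin M → EuclideanSpace ℝ (Fin d)) → Fin N → ℝ)
    (hf : DifferentiableOn ℝ f U) (hg : DifferentiableOn ℝ g U)
    (Pmat : (Fin M → EuclideanSpace ℝ (Fin d)) → Matrix (Fin M) (Fin N) ℝ)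
    (hPmat : ∀ Y i j, Pmat Y i j =
      μ i * ν j * Real.exp ((-(c (Y i) (ystar j)) + f Y i + g Y j) / ε))
    (hrowm : ∀ Y ∈ U, ∀ i, ∑ j, Pmat Y i j = μ i)
    (hcolm : ∀ Y ∈ U, ∀ j, ∑ i, Pmat Y i j = ν j)
    (S : (Fin M → EuclideanSpace ℝ (Fin d)) → ℝ)
    (hS : ∀ Y, S Y = ∑ i, ∑ j, c (Y i) (ystar j) * Pmat Y i j) :
    ∀ Y ∈ U, ∀ k : Fin M, ∀ r : Fin M ⊕ Fin N → ℝ,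
      ((Matrix.fromBlocks (Matrix.diagonal (Pmat Y *ᵥ 1)) (Pmat Y) (Pmat Y)ᵀ
          (Matrix.diagonal ((Pmat Y)ᵀ *ᵥ 1))) *ᵥ r
        = Sum.elim (fun i => ∑ j, c (Y i) (ystar j) * Pmat Y i j)
            (fun j => ∑ i, c (Y i) (ystar j) * Pmat Y i j)) →
      let B : Matrix (Fin d) (Fin N) ℝ := fun s j =>
        (fderiv ℝ (fun y => c y (ystar j)) (Y k)) (EuclideanSpace.single s 1) * Pmat Y k j
      let R : Matrix (Fin M ⊕ Fin N) (Fin d) ℝ := fun α t =>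
        Sum.elim (fun i => if i = k then ∑ j, B t j else 0) (fun j => B t j) α
      HasGradientAt (fun z => S (Function.update Y k z))
        ((∑ j, ((1 - c (Y k) (ystar j) / ε) * Pmat Y k j) •
            gradient (fun y => c y (ystar j)) (Y k)) +
          (1 / ε) • ∑ t : Fin d, (∑ α, R α t * r α) • EuclideanSpace.single t (1 : ℝ))
        (Y k) := by
  intro Y hY k r hr B R
  have hUn : U ∈ nhds Y := hU.mem_nhds hY
  have hup : Function.update Y k (Y k) = Y := Function.update_eq_self k Y
  have hU1 : HasFDerivAt (fun z => Function.update Y k z)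
      (ContinuousLinearMap.pi (Pi.single k (ContinuousLinearMap.id ℝ (EuclideanSpace ℝ (Fin d)))))
      (Y k) := hasFDerivAt_update Y (Y k)
  have hev : ∀ᶠ z in nhds (Y k), Function.update Y k z ∈ U := by
    apply hU1.continuousAt.eventually_mem
    rw [hup]; exact hUn
  obtain ⟨f', hf'⟩ : ∃ f', HasFDerivAt (fun z => f (Function.update Y k z)) f' (Y k) := by
    have h1 : HasFDerivAt f (fderiv ℝ f Y) (Function.update Y k (Y k)) := by
      rw [hup]; exact (hf.differentiableAt hUn).hasFDerivAt
    exact ⟨_, h1.comp (Y k) hU1⟩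
  obtain ⟨g', hg'⟩ : ∃ g', HasFDerivAt (fun z => g (Function.update Y k z)) g' (Y k) := by
    have h1 : HasFDerivAt g (fderiv ℝ g Y) (Function.update Y k (Y k)) := by
      rw [hup]; exact (hg.differentiableAt hUn).hasFDerivAt
    exact ⟨_, h1.comp (Y k) hU1⟩
  have hfi := fun i => (hasFDerivAt_pi'.1 hf') i
  have hgj := fun j => (hasFDerivAt_pi'.1 hg') j
  have hcd : ∀ j y, DifferentiableAt ℝ (fun y => c y (ystar j)) y := by
    intro j y
    have h1 : Differentiable ℝ (fun p : EuclideanSpace ℝ (Fin d) × EuclideanSpace ℝ (Fin d) =>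
      c p.1 p.2) := hc.differentiable (by norm_num)
    exact (h1 (y, ystar j)).comp y
      (f := fun y => (y, ystar j)) (differentiableAt_id.prodMk (differentiableAt_const _))
  set X : Fin N → (EuclideanSpace ℝ (Fin d) →L[ℝ] ℝ) :=
    fun j => fderiv ℝ (fun y => c y (ystar j)) (Y k) with hX
  have hCd : ∀ i j, HasFDerivAt (fun z => c (Function.update Y k z i) (ystar j))
      (if i = k then X j else 0) (Y k) := by
    intro i j
    by_cases hi : i = k
    · subst hi
      simp only [Function.update_self, if_true]
      exact (hcd j (Y i)).hasFDerivAt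
    · simp only [Function.update_of_ne hi, if_neg hi]
      exact hasFDerivAt_const _ _
  set D : Fin M → Fin N → (EuclideanSpace ℝ (Fin d) →L[ℝ] ℝ) := fun i j =>
    Pmat Y i j • (ε⁻¹ • (-(if i = k then X j else 0)
      + (ContinuousLinearMap.proj i).comp f' + (ContinuousLinearMap.proj j).comp g')) with hD
  have hPd : ∀ i j, HasFDerivAt (fun z => Pmat (Function.update Y k z) i j) (D i j) (Y k) := by
    intro i j
    have h1 := ((((hCd i j).neg.add (hfi i)).add (hgj j)).const_mul ε⁻¹).exp.const_mul (μ i * ν j)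
    refine (h1.congr_of_eventuallyEq ?_).congr_fderiv ?_
    · refine Filter.Eventually.of_forall fun z => ?_
      simp only [hPmat, div_eq_inv_mul, Pi.add_apply, Pi.neg_apply]
    · simp only [hD, hPmat, div_eq_inv_mul, Pi.add_apply, Pi.neg_apply, hup, smul_smul, mul_assoc]
  have hrow : ∀ i, ∑ j, D i j = 0 := by
    intro i
    have h1 := HasFDerivAt.fun_sum (u := Finset.univ) fun j _ => hPd i j
    refine h1.unique ((hasFDerivAt_const (μ i) (Y k)).congr_of_eventuallyEq ?_)
    filter_upwards [hev] with z hz using hrowm _ hz i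
  have hcol : ∀ j, ∑ i, D i j = 0 := by
    intro j
    have h1 := HasFDerivAt.fun_sum (u := Finset.univ) fun i _ => hPd i j
    refine h1.unique ((hasFDerivAt_const (ν j) (Y k)).congr_of_eventuallyEq ?_)
    filter_upwards [hev] with z hz using hcolm _ hz j
  have hSd : HasFDerivAt (fun z => S (Function.update Y k z))
      (∑ i, ∑ j, (c (Y i) (ystar j) • D i j + Pmat Y i j • (if i = k then X j else 0))) (Y k) := by
    simp only [hS]
    refine HasFDerivAt.fun_sum fun i _ => HasFDerivAt.fun_sum fun j _ => ?_
    have h1 := (hCd i j).mul (hPd i j)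
    rw [hup] at h1
    exact h1
  have hDv : ∀ i j v, D i j v = Pmat Y i j * ((-(if i = k then X j v else 0)
      + f' v i + g' v j) / ε) := by
    intro i j v
    by_cases hi : i = k <;> simp [hD, hi, div_eq_inv_mul] <;> ring
  rw [hasGradientAt_iff_hasFDerivAt]
  refine hSd.congr_fderiv ?_
  ext v
  have alg := sinkhorn_alg ε hε k (Pmat Y) (fun i j => c (Y i) (ystar j)) (f' v) (g' v)
    (fun j => X j v) (fun i => r (Sum.inl i)) (fun j => r (Sum.inr j)) ?_ ?_ ?_ ?_
  · have hl : (∑ i, ∑ j, (c (Y i) (ystar j) • D i j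
        + Pmat Y i j • (if i = k then X j else 0))) v = ∑ i, ∑ j, (c (Y i) (ystar j) * (Pmat Y i j *
        ((-(if i = k then X j v else 0) + f' v i + g' v j) / ε))
        + Pmat Y i j * (if i = k then X j v else 0)) := by
      simp only [ContinuousLinearMap.sum_apply, ContinuousLinearMap.add_apply,
        ContinuousLinearMap.smul_apply, smul_eq_mul, hDv]
      refine Finset.sum_congr rfl fun i _ => Finset.sum_congr rfl fun j _ => ?_
      by_cases hi : i = k <;> simp [hi]
    have hv : ∀ j, X j v = ∑ t, X j (EuclideanSpace.single t 1) * v t := by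
      intro j
      have h2 : v = ∑ t, v t • EuclideanSpace.single t (1:ℝ) := by
        ext s
        simp [Finset.sum_apply, Pi.single_apply]
      conv_lhs => rw [h2]
      simp [map_sum, mul_comm]
    have hgr : ∀ j, inner ℝ (gradient (fun y => c y (ystar j)) (Y k)) v = X j v := by
      intro j
      simp [gradient, hX]
    have hBt : ∀ j, ∑ t, B t j * v t = X j v * Pmat Y k j := by
      intro j
      rw [hv j, Finset.sum_mul]
      exact Finset.sum_congr rfl fun t _ => by simp only [B, hX]; ring
    have hR : ∑ t, (∑ α, R α t * r α) * v t
        = (∑ j, X j v * Pmat Y k j) * r (Sum.inl k) + ∑ j, X j v * Pmat Y k j * r (Sum.inr j) := by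
      simp only [← hBt, R, Fintype.sum_sum_type, Sum.elim_inl, Sum.elim_inr, ite_mul, zero_mul,
        Finset.sum_ite_eq', Finset.sum_ite_eq, Finset.mem_univ, if_true, add_mul,
        Finset.sum_add_distrib, Finset.sum_mul]
      congr 1
      · rw [Finset.sum_comm]
        exact Finset.sum_congr rfl fun _ _ => Finset.sum_congr rfl fun _ _ => by ring
      · rw [Finset.sum_comm]
        exact Finset.sum_congr rfl fun _ _ => Finset.sum_congr rfl fun _ _ => by ring
    rw [hl, alg, InnerProductSpace.toDual_apply_apply, inner_add_left, sum_inner, inner_smul_left,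
      sum_inner]
    simp only [inner_smul_left, hgr, EuclideanSpace.inner_single_left, ← hR]
    simp
  · intro i
    simpa only [ContinuousLinearMap.sum_apply, hDv, ContinuousLinearMap.zero_apply] using congrArg (fun L => L v) (hrow i)
  · intro j
    simpa only [ContinuousLinearMap.sum_apply, hDv, ContinuousLinearMap.zero_apply] using congrArg (fun L => L v) (hcol j)
  · intro i
    have h1 := congrFun hr (Sum.inl i)
    simp only [Matrix.fromBlocks_mulVec, Sum.elim_inl, Pi.add_apply, Matrix.mulVec_diagonal] at h1
    simpa [Matrix.mulVec, dotProduct] using h1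
  · intro j
    have h1 := congrFun hr (Sum.inr j)
    simp only [Matrix.fromBlocks_mulVec, Sum.elim_inr, Pi.add_apply, Matrix.mulVec_diagonal] at h1
    simpa [Matrix.mulVec, dotProduct] using h1
end

section
/- Let Π ∈ ℝ^{M×N} be a positive coupling matrix and C ∈ ℝ^{M×N} an arbitrary matrix. Define a ∈ ℝ^M by a_i = Σ_{j=1}^N C_{ij} Π_{ij} and b ∈ ℝ^N by b_j = Σ_{i=1}^M C_{ij} Π_{ij}. Then the linear system H(Π) r = [a; b] has a solution r ∈ ℝ^{M+N}, i.e., the vector [a; b] lies in the range of H(Π). -/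
open Matrix

/-- For a positive coupling matrix `P` and any cost matrix `C`, the vector
`[a; b]` with `a_i = Σ_j C_{ij} P_{ij}`, `b_j = Σ_i C_{ij} P_{ij}` lies in the
range of the H-matrix `H(P)`. -/
theorem stmt7 (M N : ℕ) (P : Matrix (Fin M) (Fin N) ℝ)
    (hpos : ∀ i j, 0 < P i j)
    (hsum : ∑ i, ∑ j, P i j = 1)
    (C : Matrix (Fin M) (Fin N) ℝ) :
    ∃ r : Fin M ⊕ Fin N → ℝ,
      (Matrix.fromBlocks (Matrix.diagonal (P *ᵥ 1)) P Pᵀ (Matrix.diagonal (Pᵀ *ᵥ 1))) *ᵥ r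
        = Sum.elim (fun i => ∑ j, C i j * P i j) (fun j => ∑ i, C i j * P i j) := by
  classical
  obtain ⟨B, hB1, hB2⟩ : ∃ B : Matrix (Fin M ⊕ Fin N) (Fin M × Fin N) ℝ,
      (∀ i k l, B (Sum.inl i) (k, l) = if i = k then Real.sqrt (P k l) else 0) ∧
      (∀ j k l, B (Sum.inr j) (k, l) = if j = l then Real.sqrt (P k l) else 0) :=
    ⟨Matrix.of fun s p =>
      Sum.elim (fun i => if i = p.1 then Real.sqrt (P p.1 p.2) else 0)
        (fun j => if j = p.2 then Real.sqrt (P p.1 p.2) else 0) s,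
      fun _ _ _ => rfl, fun _ _ _ => rfl⟩
  have hs : ∀ i j, Real.sqrt (P i j) * Real.sqrt (P i j) = P i j := fun i j =>
    Real.mul_self_sqrt (hpos i j).le
  have hH : Matrix.fromBlocks (Matrix.diagonal (P *ᵥ 1)) P Pᵀ (Matrix.diagonal (Pᵀ *ᵥ 1))
      = B * Bᵀ := by
    ext s t
    rcases s with i | j <;> rcases t with k | l
    · simp only [hB1, hB2, Matrix.mul_apply, Fintype.sum_prod_type, Matrix.fromBlocks_apply₁₁,
        Matrix.transpose_apply, Sum.elim_inl, Matrix.diagonal_apply, ite_mul, zero_mul,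
        mul_ite, mul_zero, Matrix.mulVec, dotProduct, Pi.one_apply, mul_one]
      rw [Finset.sum_comm]
      simp [hs]
      split_ifs with h <;> simp [h]
    · simp [hB1, hB2, Matrix.mul_apply, Fintype.sum_prod_type, hs]
    · simp [hB1, hB2, Matrix.mul_apply, Fintype.sum_prod_type, hs]
    · simp only [hB1, hB2, Matrix.mul_apply, Fintype.sum_prod_type, Matrix.fromBlocks_apply₂₂,
        Matrix.transpose_apply, Sum.elim_inr, Matrix.diagonal_apply, ite_mul, zero_mul,
        mul_ite, mul_zero, Matrix.mulVec, dotProduct, Pi.one_apply, mul_one]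
      simp [hs]
      split_ifs with h <;> simp [h]
  have hv : B *ᵥ (fun p => Real.sqrt (P p.1 p.2) * C p.1 p.2)
      = Sum.elim (fun i => ∑ j, C i j * P i j) (fun j => ∑ i, C i j * P i j) := by
    ext s
    rcases s with i | j
    · simp only [hB1, hB2, Matrix.mulVec, dotProduct, Fintype.sum_prod_type, Sum.elim_inl, ite_mul,
        zero_mul, ← mul_assoc, hs]
      rw [Finset.sum_comm]
      simp [mul_comm]
    · simp only [hB1, hB2, Matrix.mulVec, dotProduct, Fintype.sum_prod_type, Sum.elim_inr, ite_mul,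
        zero_mul, ← mul_assoc, hs]
      simp [mul_comm]
  have hle : LinearMap.range (B * Bᵀ).mulVecLin ≤ LinearMap.range B.mulVecLin := by
    rw [Matrix.mulVecLin_mul]
    exact LinearMap.range_comp_le_range _ _
  have heq : LinearMap.range (B * Bᵀ).mulVecLin = LinearMap.range B.mulVecLin :=
    Submodule.eq_of_le_of_finrank_eq hle (Matrix.rank_self_mul_transpose B)
  have hmem : B *ᵥ (fun p => Real.sqrt (P p.1 p.2) * C p.1 p.2)
      ∈ LinearMap.range (B * Bᵀ).mulVecLin := by
    rw [heq]
    exact ⟨_, rfl⟩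
  obtain ⟨r, hr⟩ := hmem
  refine ⟨r, ?_⟩
  rw [hH, ← hv]
  exact hr
end

section
/- In the dual-potential setup, assume additionally that f and g are twice continuously differentiable on U. For Y ∈ U and 1 ≤ s ≤ M let V_s(Y) = [∂f/∂y_s; ∂g/∂y_s] ∈ ℝ^{(M+N)×d} be the stacked Jacobian. Then for all 1 ≤ k, s ≤ M the second partial derivative of OT_ε(Y) = μᵀ f(Y) + νᵀ g(Y) satisfies ∂²OT_ε/∂y_s ∂y_k (Y) = (1/ε) R_k(Y)ᵀ V_s(Y) + δ_{ks} Σ_{j=1}^N Π_{kj}(Y) ( ∇²_y c(y_k, y*_j) − (1/ε) ∇_y c(y_k, y*_j) ∇_y c(y_k, y*_j)ᵀ ) ∈ ℝ^{d×d}, where δ_{ks} is the Kronecker delta, ∇_y c and ∇²_y c denote the gradient and Hessian of c in its first argument, R_k(Y) = [e_k (B_k 1_N)ᵀ; B_kᵀ] ∈ ℝ^{(M+N)×d}, and B_k(Y) ∈ ℝ^{d×N} has entries (B_k)_{sj} = (∂c/∂(y)_s)(y_k, y*_j) · Π_{kj}(Y). -/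
open Matrix

/-- Hessian of the entropic OT dual value: the second partial derivative
`∂²OT_ε/∂y_s∂y_k` (expressed entrywise via directional derivatives along
coordinate directions) equals `(1/ε) R_kᵀ V_s` plus the diagonal (k = s)
correction `Σ_j Π_{kj} (∇²_y c - (1/ε) ∇_y c ∇_y cᵀ)`. -/
theorem stmt8 (ε : ℝ) (hε : 0 < ε) (M N d : ℕ) (hM : 1 ≤ M) (hN : 1 ≤ N) (hd : 1 ≤ d)
    (ystar : Fin N → EuclideanSpace ℝ (Fin d))
    (c : EuclideanSpace ℝ (Fin d) → EuclideanSpace ℝ (Fin d) → ℝ)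
    (hc : ContDiff ℝ 2 (fun p : EuclideanSpace ℝ (Fin d) × EuclideanSpace ℝ (Fin d) =>
      c p.1 p.2))
    (μ : Fin M → ℝ) (ν : Fin N → ℝ)
    (hμ : ∀ i, 0 < μ i) (hν : ∀ j, 0 < ν j)
    (hμ1 : ∑ i, μ i = 1) (hν1 : ∑ j, ν j = 1)
    (U : Set (Fin M → EuclideanSpace ℝ (Fin d))) (hU : IsOpen U)
    (f : (Fin M → EuclideanSpace ℝ (Fin d)) → Fin M → ℝ)
    (g : (Fin M → EuclideanSpace ℝ (Fin d)) → Fin N → ℝ)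
    (hf : ContDiffOn ℝ 2 f U) (hg : ContDiffOn ℝ 2 g U)
    (Pmat : (Fin M → EuclideanSpace ℝ (Fin d)) → Matrix (Fin M) (Fin N) ℝ)
    (hPmat : ∀ Y i j, Pmat Y i j =
      μ i * ν j * Real.exp ((-(c (Y i) (ystar j)) + f Y i + g Y j) / ε))
    (hrowm : ∀ Y ∈ U, ∀ i, ∑ j, Pmat Y i j = μ i)
    (hcolm : ∀ Y ∈ U, ∀ j, ∑ i, Pmat Y i j = ν j)
    (OTe : (Fin M → EuclideanSpace ℝ (Fin d)) → ℝ)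
    (hOT : ∀ Y, OTe Y = (∑ i, μ i * f Y i) + ∑ j, ν j * g Y j) :
    ∀ Y ∈ U, ∀ k s : Fin M, ∀ t l : Fin d,
      let B : Fin M → Matrix (Fin d) (Fin N) ℝ := fun k' => fun s' j =>
        (fderiv ℝ (fun y => c y (ystar j)) (Y k')) (EuclideanSpace.single s' 1) * Pmat Y k' j
      let R : Fin M → Matrix (Fin M ⊕ Fin N) (Fin d) ℝ := fun k' => fun α t' =>
        Sum.elim (fun i => if i = k' then ∑ j, B k' t' j else 0) (fun j => B k' t' j) α
      let V : Fin M → Matrix (Fin M ⊕ Fin N) (Fin d) ℝ := fun s' => fun α l' =>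
        Sum.elim
          (fun i => (fderiv ℝ (fun Y' => f Y' i) Y)
            (Pi.single s' (EuclideanSpace.single l' 1)))
          (fun j => (fderiv ℝ (fun Y' => g Y' j) Y)
            (Pi.single s' (EuclideanSpace.single l' 1))) α
      (fderiv ℝ (fun Y' => (fderiv ℝ OTe Y') (Pi.single k (EuclideanSpace.single t 1))) Y)
          (Pi.single s (EuclideanSpace.single l 1))
        = (1 / ε) * (∑ α, R k α t * V s α l) +
          (if k = s then
            ∑ j, Pmat Y k j *
              ((fderiv ℝ (fun y =>
                  (fderiv ℝ (fun y' => c y' (ystar j)) y) (EuclideanSpace.single t 1)) (Y k))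
                  (EuclideanSpace.single l 1) -
                (1 / ε) *
                  ((fderiv ℝ (fun y => c y (ystar j)) (Y k)) (EuclideanSpace.single t 1)) *
                  ((fderiv ℝ (fun y => c y (ystar j)) (Y k)) (EuclideanSpace.single l 1)))
          else 0) := by
  intro Y hY k s t l B R V
  have hcj : ∀ j, ContDiff ℝ 2 (fun y => c y (ystar j)) := fun j =>
    hc.comp (contDiff_id.prodMk contDiff_const)
  have hcd : ∀ j y, HasFDerivAt (fun y => c y (ystar j))
      (fderiv ℝ (fun y => c y (ystar j)) y) y := fun j y =>
    (((hcj j).differentiable (by norm_num)) y).hasFDerivAt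
  have hfd : ∀ Z ∈ U, ∀ i, HasFDerivAt (fun Y' => f Y' i)
      (fderiv ℝ (fun Y' => f Y' i) Z) Z := fun Z hZ i =>
    (differentiableAt_pi.1 ((hf.contDiffAt (hU.mem_nhds hZ)).differentiableAt
      (by norm_num)) i).hasFDerivAt
  have hgd : ∀ Z ∈ U, ∀ j, HasFDerivAt (fun Y' => g Y' j)
      (fderiv ℝ (fun Y' => g Y' j) Z) Z := fun Z hZ j =>
    (differentiableAt_pi.1 ((hg.contDiffAt (hU.mem_nhds hZ)).differentiableAt
      (by norm_num)) j).hasFDerivAt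
  have hproj : ∀ (Z : Fin M → EuclideanSpace ℝ (Fin d)) (i : Fin M),
      HasFDerivAt (fun Y' : Fin M → EuclideanSpace ℝ (Fin d) => Y' i)
      (ContinuousLinearMap.proj (R := ℝ) (φ := fun _ : Fin M => EuclideanSpace ℝ (Fin d)) i) Z :=
    fun Z i => hasFDerivAt_apply i Z
  have hPd : ∀ Z ∈ U, ∀ i j, HasFDerivAt (fun Y' => Pmat Y' i j)
      ((Pmat Z i j * (1 / ε)) •
        (-((fderiv ℝ (fun y => c y (ystar j)) (Z i)).comp
            (ContinuousLinearMap.proj (R := ℝ)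
              (φ := fun _ : Fin M => EuclideanSpace ℝ (Fin d)) i)) +
          fderiv ℝ (fun Y' => f Y' i) Z + fderiv ℝ (fun Y' => g Y' j) Z)) Z := by
    intro Z hZ i j
    have h1 := ((((HasFDerivAt.comp Z (hcd j (Z i)) (hproj Z i)).neg.add (hfd Z hZ i)).add
      (hgd Z hZ j)).mul_const (1 / ε)).exp.const_mul (μ i * ν j)
    have e : (fun Y' => Pmat Y' i j) = fun Y' => μ i * ν j *
        Real.exp ((-(c (Y' i) (ystar j)) + f Y' i + g Y' j) * (1 / ε)) := by
      funext Y'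
      rw [hPmat, mul_one_div]
    rw [e]
    refine HasFDerivAt.congr_fderiv h1 ?_
    ext h
    rw [hPmat Z i j, ← mul_one_div _ ε]
    simp only [_root_.add_apply,
      _root_.smul_apply, _root_.neg_apply,
      ContinuousLinearMap.comp_apply, ContinuousLinearMap.proj_apply, smul_eq_mul,
      Pi.add_apply, Pi.neg_apply, Function.comp_apply]
    ring
  have hOd : ∀ Z ∈ U, fderiv ℝ OTe Z (Pi.single k (EuclideanSpace.single t 1)) =
      ∑ j, Pmat Z k j *
        (fderiv ℝ (fun y => c y (ystar j)) (Z k)) (EuclideanSpace.single t 1) := by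
    intro Z hZ
    have h1 : HasFDerivAt OTe ((∑ i, μ i • fderiv ℝ (fun Y' => f Y' i) Z) +
        ∑ j, ν j • fderiv ℝ (fun Y' => g Y' j) Z) Z := by
      rw [show OTe = _ from funext hOT]
      exact (HasFDerivAt.fun_sum fun i _ => (hfd Z hZ i).const_mul (μ i)).add
        (HasFDerivAt.fun_sum fun j _ => (hgd Z hZ j).const_mul (ν j))
    have h2 := HasFDerivAt.fun_sum (u := Finset.univ) fun i _ =>
      HasFDerivAt.fun_sum (u := Finset.univ) fun j _ => hPd Z hZ i j
    have h3 : HasFDerivAt (fun Y' => ∑ i, ∑ j, Pmat Y' i j)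
        (0 : (Fin M → EuclideanSpace ℝ (Fin d)) →L[ℝ] ℝ) Z := by
      refine (hasFDerivAt_const (1 : ℝ) Z).congr_of_eventuallyEq ?_
      filter_upwards [hU.mem_nhds hZ] with W hW
      simp only [hrowm W hW, hμ1]
    have h4 := congrArg (fun L : (Fin M → EuclideanSpace ℝ (Fin d)) →L[ℝ] ℝ =>
      L (Pi.single k (EuclideanSpace.single t 1))) (h2.unique h3)
    rw [h1.fderiv]
    simp only [_root_.sum_apply, _root_.add_apply,
      _root_.smul_apply, _root_.neg_apply,
      ContinuousLinearMap.comp_apply, ContinuousLinearMap.proj_apply, smul_eq_mul,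
      _root_.zero_apply] at h4 ⊢
    have h5 : ∑ i, ∑ j, Pmat Z i j * (fderiv ℝ (fun y => c y (ystar j)) (Z i))
        ((Pi.single k (EuclideanSpace.single t 1) : Fin M → EuclideanSpace ℝ (Fin d)) i) =
        ∑ j, Pmat Z k j *
          (fderiv ℝ (fun y => c y (ystar j)) (Z k)) (EuclideanSpace.single t 1) := by
      rw [Finset.sum_eq_single k]
      · simp only [Pi.single_eq_same]
      · intro i _ hi
        simp only [Pi.single_eq_of_ne hi, map_zero, mul_zero, Finset.sum_const_zero]
      · simp
    rw [← h5]
    generalize (Pi.single k (EuclideanSpace.single t 1) :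
      Fin M → EuclideanSpace ℝ (Fin d)) = h at h4 ⊢
    have h6 : ∑ i, μ i * (fderiv ℝ (fun Y' => f Y' i) Z) h =
        ∑ i, ∑ j, Pmat Z i j * (fderiv ℝ (fun Y' => f Y' i) Z) h :=
      Finset.sum_congr rfl fun i _ => by rw [← hrowm Z hZ i, Finset.sum_mul]
    have h7 : ∑ j, ν j * (fderiv ℝ (fun Y' => g Y' j) Z) h =
        ∑ i, ∑ j, Pmat Z i j * (fderiv ℝ (fun Y' => g Y' j) Z) h := by
      rw [Finset.sum_comm]
      exact Finset.sum_congr rfl fun j _ => by rw [← hcolm Z hZ j, Finset.sum_mul]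
    rw [h6, h7, ← sub_eq_zero]
    simp only [← Finset.sum_add_distrib, ← Finset.sum_sub_distrib]
    have h8 := congrArg (fun x => ε * x) h4
    simp only [Finset.mul_sum, mul_zero] at h8
    rw [← h8]
    refine Finset.sum_congr rfl fun i _ => Finset.sum_congr rfl fun j _ => ?_
    field_simp
    ring
  have hev : (fun Y' => (fderiv ℝ OTe Y') (Pi.single k (EuclideanSpace.single t 1)))
      =ᶠ[nhds Y] fun Z => ∑ j, Pmat Z k j *
        (fderiv ℝ (fun y => c y (ystar j)) (Z k)) (EuclideanSpace.single t 1) := by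
    filter_upwards [hU.mem_nhds hY] with W hW using hOd W hW
  rw [hev.fderiv_eq]
  have hc2 : ∀ j, HasFDerivAt (fun y =>
      (fderiv ℝ (fun y' => c y' (ystar j)) y) (EuclideanSpace.single t 1))
      (fderiv ℝ (fun y =>
        (fderiv ℝ (fun y' => c y' (ystar j)) y) (EuclideanSpace.single t 1)) (Y k)) (Y k) := by
    intro j
    have h1 : Differentiable ℝ (fderiv ℝ (fun y' => c y' (ystar j))) :=
      ((hcj j).fderiv_right (m := 1) (by norm_num)).differentiable (by norm_num)
    exact ((h1 (Y k)).clm_apply (differentiableAt_const _)).hasFDerivAt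
  have hfin := HasFDerivAt.fun_sum (u := Finset.univ) fun j _ =>
    (hPd Y hY k j).mul (HasFDerivAt.comp Y (hc2 j) (hproj Y k))
  have := hfin.fderiv
  simp only [Function.comp_def, Pi.mul_apply] at this
  rw [this]
  simp only [_root_.sum_apply, _root_.add_apply,
      _root_.smul_apply, _root_.neg_apply,
      ContinuousLinearMap.comp_apply, ContinuousLinearMap.proj_apply, smul_eq_mul,
      Fintype.sum_sum_type, R, V, B, Sum.elim_inl, Sum.elim_inr, ite_mul, zero_mul,
      Finset.sum_ite_eq', Finset.mem_univ, if_true, Finset.sum_mul]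
  rw [← Finset.sum_add_distrib, Finset.mul_sum]
  by_cases hks : k = s
  · subst hks
    simp only [if_true, Pi.single_eq_same]
    rw [← Finset.sum_add_distrib]
    refine Finset.sum_congr rfl fun j _ => ?_
    ring
  · simp only [if_neg hks, Pi.single_eq_of_ne hks, map_zero, add_zero]
    refine Finset.sum_congr rfl fun j _ => ?_
    ring
end

section
/- In the dual-potential setup with the squared Euclidean cost c(y, y') = ‖y − y'‖₂², and assuming f and g are twice continuously differentiable on U, the second derivatives of OT_ε(Y) = μᵀ f(Y) + νᵀ g(Y) satisfy, for every Y ∈ U and every 1 ≤ s ≤ M: Σ_{k=1}^{M} ∂²OT_ε/∂y_s ∂y_k (Y) = 2 μ_s I_d, where I_d is the d×d identity matrix. -/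
open Matrix

/-- Marginal identity for the Hessian of the entropic OT dual value with squared
Euclidean cost: `Σ_k ∂²OT_ε/∂y_s∂y_k (Y) = 2 μ_s I_d`, entrywise. -/
theorem stmt9 (ε : ℝ) (hε : 0 < ε) (M N d : ℕ) (hM : 1 ≤ M) (hN : 1 ≤ N) (hd : 1 ≤ d)
    (ystar : Fin N → EuclideanSpace ℝ (Fin d))
    (μ : Fin M → ℝ) (ν : Fin N → ℝ)
    (hμ : ∀ i, 0 < μ i) (hν : ∀ j, 0 < ν j)
    (hμ1 : ∑ i, μ i = 1) (hν1 : ∑ j, ν j = 1)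
    (U : Set (Fin M → EuclideanSpace ℝ (Fin d))) (hU : IsOpen U)
    (f : (Fin M → EuclideanSpace ℝ (Fin d)) → Fin M → ℝ)
    (g : (Fin M → EuclideanSpace ℝ (Fin d)) → Fin N → ℝ)
    (hf : ContDiffOn ℝ 2 f U) (hg : ContDiffOn ℝ 2 g U)
    (Pmat : (Fin M → EuclideanSpace ℝ (Fin d)) → Matrix (Fin M) (Fin N) ℝ)
    (hPmat : ∀ Y i j, Pmat Y i j =
      μ i * ν j * Real.exp ((-(‖Y i - ystar j‖ ^ 2) + f Y i + g Y j) / ε))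
    (hrowm : ∀ Y ∈ U, ∀ i, ∑ j, Pmat Y i j = μ i)
    (hcolm : ∀ Y ∈ U, ∀ j, ∑ i, Pmat Y i j = ν j)
    (OTe : (Fin M → EuclideanSpace ℝ (Fin d)) → ℝ)
    (hOT : ∀ Y, OTe Y = (∑ i, μ i * f Y i) + ∑ j, ν j * g Y j) :
    ∀ Y ∈ U, ∀ s : Fin M, ∀ t l : Fin d,
      (∑ k : Fin M,
          (fderiv ℝ (fun Y' => (fderiv ℝ OTe Y') (Pi.single k (EuclideanSpace.single t 1))) Y)
            (Pi.single s (EuclideanSpace.single l 1)))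
        = 2 * μ s * (if t = l then (1 : ℝ) else 0) := by
  classical
  intro Y hY s t l
  have hfi : ∀ i, ContDiffOn ℝ 2 (fun Y => f Y i) U := fun i => contDiffOn_pi.1 hf i
  have hgj : ∀ j, ContDiffOn ℝ 2 (fun Y => g Y j) U := fun j => contDiffOn_pi.1 hg j
  have hOTe : OTe = fun Y => (∑ i, μ i * f Y i) + ∑ j, ν j * g Y j := funext hOT
  have hOC : ContDiffOn ℝ 2 OTe U := by
    rw [hOTe]
    exact (ContDiffOn.sum fun i _ => contDiffOn_const.mul (hfi i)).add
      (ContDiffOn.sum fun j _ => contDiffOn_const.mul (hgj j))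
  have hD : DifferentiableAt ℝ (fderiv ℝ OTe) Y :=
    ((hOC.fderiv_of_isOpen hU (m := 1) (by norm_num)).differentiableOn
      (by norm_num)).differentiableAt (hU.mem_nhds hY)
  set w : Fin M → EuclideanSpace ℝ (Fin d) := fun _ => EuclideanSpace.single t 1 with hw
  have hwsum : ∑ k : Fin M, (Pi.single k (EuclideanSpace.single t (1:ℝ)) :
      Fin M → EuclideanSpace ℝ (Fin d)) = w := by
    rw [hw]
    exact Finset.univ_sum_single (fun _ : Fin M => EuclideanSpace.single t (1:ℝ))
  -- the first derivative in the direction w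
  have key : ∀ Z ∈ U, fderiv ℝ OTe Z w =
      2 * ∑ i, μ i * Z i t - 2 * ∑ j, ν j * ystar j t := by
    intro Z hZ
    have hF : ∀ i, HasFDerivAt (fun Y => f Y i) (fderiv ℝ (fun Y => f Y i) Z) Z := fun i =>
      (((hfi i).differentiableOn (by norm_num)).differentiableAt (hU.mem_nhds hZ)).hasFDerivAt
    have hG : ∀ j, HasFDerivAt (fun Y => g Y j) (fderiv ℝ (fun Y => g Y j) Z) Z := fun j =>
      (((hgj j).differentiableOn (by norm_num)).differentiableAt (hU.mem_nhds hZ)).hasFDerivAt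
    generalize hFe : (fun i => fderiv ℝ (fun Y => f Y i) Z) = F
    generalize hGe : (fun j => fderiv ℝ (fun Y => g Y j) Z) = G
    replace hF : ∀ i, HasFDerivAt (fun Y => f Y i) (F i) Z := by
      intro i; rw [← hFe]; exact hF i
    replace hG : ∀ j, HasFDerivAt (fun Y => g Y j) (G j) Z := by
      intro j; rw [← hGe]; exact hG j
    have hO : HasFDerivAt OTe ((∑ i, μ i • F i) + ∑ j, ν j • G j) Z := by
      rw [hOTe]
      exact (HasFDerivAt.fun_sum fun i _ => (hF i).const_mul (μ i)).add
        (HasFDerivAt.fun_sum fun j _ => (hG j).const_mul (ν j))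
    have hC : ∀ i j, HasFDerivAt (fun Y : Fin M → EuclideanSpace ℝ (Fin d) =>
        ‖Y i - ystar j‖ ^ 2) (2 • (innerSL ℝ (Z i - ystar j)).comp
          (ContinuousLinearMap.proj (R := ℝ) (φ := fun _ : Fin M => EuclideanSpace ℝ (Fin d)) i)) Z := by
      intro i j
      exact ((hasFDerivAt_apply i Z).sub_const (ystar j)).norm_sq
    have hP : ∀ i j, HasFDerivAt (fun Y => Pmat Y i j) ((Pmat Z i j / ε) •
        (-(2 • (innerSL ℝ (Z i - ystar j)).comp
          (ContinuousLinearMap.proj (R := ℝ) (φ := fun _ : Fin M => EuclideanSpace ℝ (Fin d)) i))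
          + F i + G j)) Z := by
      intro i j
      have h1 := (((((hC i j).neg.add (hF i)).add (hG j)).mul_const ε⁻¹).exp).const_mul (μ i * ν j)
      have h2 : (fun Y => Pmat Y i j) = fun Y => μ i * ν j *
          Real.exp ((-(‖Y i - ystar j‖ ^ 2) + f Y i + g Y j) * ε⁻¹) := by
        funext Y; rw [hPmat, div_eq_mul_inv]
      rw [h2]
      refine h1.congr_fderiv ?_
      rw [hPmat, smul_smul, smul_smul, div_eq_mul_inv, div_eq_mul_inv]
      rfl
    have hS := HasFDerivAt.fun_sum (u := Finset.univ) fun i _ =>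
      HasFDerivAt.fun_sum (u := Finset.univ) fun j _ => hP i j
    have hS0 : HasFDerivAt (fun Y => ∑ i, ∑ j, Pmat Y i j) (0 : _ →L[ℝ] ℝ) Z := by
      refine (hasFDerivAt_const (1:ℝ) Z).congr_of_eventuallyEq ?_
      filter_upwards [hU.mem_nhds hZ] with Y hY
      rw [← hμ1]
      exact Finset.sum_congr rfl fun i _ => hrowm Y hY i
    have hE := congrArg (fun L => L w) (hS.unique hS0)
    simp only [ContinuousLinearMap.sum_apply, ContinuousLinearMap.smul_apply,
      ContinuousLinearMap.add_apply, ContinuousLinearMap.neg_apply, ContinuousLinearMap.comp_apply,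
      ContinuousLinearMap.proj_apply, innerSL_apply_apply, ContinuousLinearMap.zero_apply, hw,
      EuclideanSpace.inner_single_right, smul_eq_mul, nsmul_eq_mul] at hE
    rw [hO.fderiv]
    simp only [ContinuousLinearMap.sum_apply, ContinuousLinearMap.smul_apply,
      ContinuousLinearMap.add_apply, smul_eq_mul]
    have a1 : ∑ i, μ i * F i w = ∑ i, ∑ j, Pmat Z i j * F i w :=
      Finset.sum_congr rfl fun i _ => by rw [← Finset.sum_mul, hrowm Z hZ i]
    have a2 : ∑ j, ν j * G j w = ∑ i, ∑ j, Pmat Z i j * G j w := by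
      rw [Finset.sum_comm]
      exact Finset.sum_congr rfl fun j _ => by rw [← Finset.sum_mul, hcolm Z hZ j]
    have a3 : ∑ i, μ i * Z i t = ∑ i, ∑ j, Pmat Z i j * Z i t :=
      Finset.sum_congr rfl fun i _ => by rw [← Finset.sum_mul, hrowm Z hZ i]
    have a4 : ∑ j, ν j * ystar j t = ∑ i, ∑ j, Pmat Z i j * ystar j t := by
      rw [Finset.sum_comm]
      exact Finset.sum_congr rfl fun j _ => by rw [← Finset.sum_mul, hcolm Z hZ j]
    rw [a1, a2, a3, a4, ← sub_eq_zero]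
    rw [← mul_zero ε, ← hE]
    simp only [Finset.mul_sum, ← Finset.sum_add_distrib, ← Finset.sum_sub_distrib]
    refine Finset.sum_congr rfl fun i _ => Finset.sum_congr rfl fun j _ => ?_
    simp [hw]
    field_simp
    ring
  have e1 : ∀ k : Fin M,
      (fderiv ℝ (fun Y' => (fderiv ℝ OTe Y') (Pi.single k (EuclideanSpace.single t 1))) Y)
        = (fderiv ℝ (fderiv ℝ OTe) Y).flip (Pi.single k (EuclideanSpace.single t 1)) := by
    intro k
    ext v
    rw [fderiv_clm_apply hD (differentiableAt_const _)]
    simp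
  simp only [e1]
  rw [← ContinuousLinearMap.sum_apply, ← map_sum, hwsum]
  have e2 : (fderiv ℝ (fderiv ℝ OTe) Y).flip w = fderiv ℝ (fun Y' => fderiv ℝ OTe Y' w) Y := by
    ext v
    rw [fderiv_clm_apply hD (differentiableAt_const _)]
    simp
  have e3 : (fun Y' => fderiv ℝ OTe Y' w) =ᶠ[nhds Y]
      fun Z => 2 * ∑ i, μ i * Z i t - 2 * ∑ j, ν j * ystar j t := by
    filter_upwards [hU.mem_nhds hY] with Z hZ using key Z hZ
  have e4 : HasFDerivAt (fun Z : Fin M → EuclideanSpace ℝ (Fin d) =>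
      2 * ∑ i, μ i * Z i t - 2 * ∑ j, ν j * ystar j t)
      ((2:ℝ) • ∑ i, μ i • ((EuclideanSpace.proj t : EuclideanSpace ℝ (Fin d) →L[ℝ] ℝ).comp
        (ContinuousLinearMap.proj (R := ℝ) (φ := fun _ : Fin M => EuclideanSpace ℝ (Fin d)) i))) Y := by
    refine HasFDerivAt.sub_const _ ?_
    refine HasFDerivAt.const_mul ?_ _
    refine HasFDerivAt.fun_sum fun i _ => ?_
    refine HasFDerivAt.const_mul ?_ _
    exact ((EuclideanSpace.proj t : EuclideanSpace ℝ (Fin d) →L[ℝ] ℝ).comp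
      (ContinuousLinearMap.proj (R := ℝ)
        (φ := fun _ : Fin M => EuclideanSpace ℝ (Fin d)) i)).hasFDerivAt
  rw [e2, e3.fderiv_eq, e4.fderiv]
  simp only [ContinuousLinearMap.sum_apply, ContinuousLinearMap.smul_apply,
    ContinuousLinearMap.comp_apply, ContinuousLinearMap.proj_apply, smul_eq_mul]
  rw [Finset.sum_eq_single s]
  · simp [mul_assoc, Pi.single_apply]
  · intro i _ hi
    simp [Pi.single_eq_of_ne hi]
  · simp
end

section
/- Let M ≤ N and let Π ∈ ℝ^{M×N} be a coupling matrix with uniform marginals. (i) If u ∈ ℝ^M is nonzero and σ > 0 satisfies Π Πᵀ u = σ² u, then both numbers λ_± = ( (1/M + 1/N) ± √( (1/M − 1/N)² + 4σ² ) ) / 2 are eigenvalues of H(Π). (ii) If v ∈ ℝ^N satisfies Π v = 0, then H(Π) [0_M; v] = (1/N) [0_M; v]; in particular, if rank(Π) = M then 1/N is an eigenvalue of H(Π) whose eigenspace has dimension at least N − M. -/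
open Matrix

theorem stmt10_aux (M N : ℕ) (P : Matrix (Fin M) (Fin N) ℝ) (a b l σ : ℝ) (hσ : 0 < σ)
    (hl : (l - a) * (l - b) = σ ^ 2) (u : Fin M → ℝ) (hu : u ≠ 0)
    (h : (P * Pᵀ) *ᵥ u = (σ ^ 2) • u) :
    ∃ w : Fin M ⊕ Fin N → ℝ, w ≠ 0 ∧
      Matrix.fromBlocks (Matrix.diagonal (fun _ => a)) P Pᵀ
        (Matrix.diagonal (fun _ => b)) *ᵥ w = l • w := by
  have hb : l - b ≠ 0 := by
    intro h0
    rw [h0] at hl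
    have : 0 < σ ^ 2 := by positivity
    linarith
  refine ⟨Sum.elim ((l - b) • u) (Pᵀ *ᵥ u), ?_, ?_⟩
  · intro h0
    apply hu
    ext i
    have := congrFun h0 (Sum.inl i)
    simpa [hb] using this
  · rw [Matrix.fromBlocks_mulVec]
    ext i
    rcases i with i | i
    · have := congrFun h i
      simp only [← Matrix.mulVec_mulVec, Pi.smul_apply, smul_eq_mul] at this
      simp only [Sum.elim_comp_inl, Sum.elim_comp_inr, Sum.elim_inl, Pi.add_apply,
        Matrix.mulVec_diagonal, Pi.smul_apply, smul_eq_mul, this]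
      linear_combination (-u i) * hl
    · simp only [Sum.elim_comp_inl, Sum.elim_comp_inr, Sum.elim_inr, Pi.add_apply,
        Matrix.mulVec_diagonal, Pi.smul_apply, smul_eq_mul, Matrix.mulVec_smul]
      ring

/-- Eigenvalues of the H-matrix of a coupling matrix with uniform marginals:
(i) every positive singular value `σ` of `P` produces the two eigenvalues `λ±`;
(ii) kernel vectors of `P` produce the eigenvalue `1/N`, whose eigenspace has
dimension at least `N - M` when `P` has full rank `M`. -/
theorem stmt10 (M N : ℕ) (hMN : M ≤ N) (P : Matrix (Fin M) (Fin N) ℝ)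
    (hnn : ∀ i j, 0 ≤ P i j)
    (hrow : P *ᵥ 1 = fun _ => 1 / (M : ℝ))
    (hcol : Pᵀ *ᵥ 1 = fun _ => 1 / (N : ℝ)) :
    let H : Matrix (Fin M ⊕ Fin N) (Fin M ⊕ Fin N) ℝ :=
      Matrix.fromBlocks (Matrix.diagonal (P *ᵥ 1)) P Pᵀ (Matrix.diagonal (Pᵀ *ᵥ 1))
    (∀ (u : Fin M → ℝ) (σ : ℝ), u ≠ 0 → 0 < σ → (P * Pᵀ) *ᵥ u = (σ ^ 2) • u →
      (∃ w : Fin M ⊕ Fin N → ℝ, w ≠ 0 ∧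
        H *ᵥ w = (((1 / (M : ℝ) + 1 / (N : ℝ)) +
          Real.sqrt ((1 / (M : ℝ) - 1 / (N : ℝ)) ^ 2 + 4 * σ ^ 2)) / 2) • w) ∧
      (∃ w : Fin M ⊕ Fin N → ℝ, w ≠ 0 ∧
        H *ᵥ w = (((1 / (M : ℝ) + 1 / (N : ℝ)) -
          Real.sqrt ((1 / (M : ℝ) - 1 / (N : ℝ)) ^ 2 + 4 * σ ^ 2)) / 2) • w)) ∧
    (∀ v : Fin N → ℝ, P *ᵥ v = 0 →
      H *ᵥ (Sum.elim (0 : Fin M → ℝ) v) = (1 / (N : ℝ)) • Sum.elim (0 : Fin M → ℝ) v) ∧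
    (P.rank = M →
      N - M ≤ Module.finrank ℝ
        (Module.End.eigenspace (Matrix.toLin' H) (1 / (N : ℝ)))) := by
  intro H
  have hker : ∀ v : Fin N → ℝ, P *ᵥ v = 0 →
      H *ᵥ (Sum.elim (0 : Fin M → ℝ) v) = (1 / (N : ℝ)) • Sum.elim (0 : Fin M → ℝ) v := by
    intro v hv
    simp only [H, hcol]
    rw [Matrix.fromBlocks_mulVec]
    ext i
    rcases i with i | i
    · simp [hv]
    · simp [Matrix.mulVec_diagonal]
  refine ⟨?_, hker, ?_⟩
  · intro u σ hu hσ h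
    have hs := Real.sq_sqrt (show 0 ≤ (1 / (M : ℝ) - 1 / (N : ℝ)) ^ 2 + 4 * σ ^ 2 by positivity)
    simp only [H, hrow, hcol]
    constructor
    · refine stmt10_aux M N P _ _ _ σ hσ ?_ u hu h
      linear_combination hs / 4
    · refine stmt10_aux M N P _ _ _ σ hσ ?_ u hu h
      linear_combination hs / 4
  · intro hr
    have h1 := LinearMap.finrank_range_add_finrank_ker P.mulVecLin
    have h2 : Module.finrank ℝ (LinearMap.range P.mulVecLin) = M := hr
    rw [h2, Module.finrank_fin_fun] at h1
    let f : (Fin N → ℝ) →ₗ[ℝ] (Fin M ⊕ Fin N → ℝ) :=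
      { toFun := fun v => Sum.elim 0 v
        map_add' := by
          intro x y
          ext i
          rcases i with i | i <;> simp
        map_smul' := by
          intro c x
          ext i
          rcases i with i | i <;> simp }
    have hf : Function.Injective f := by
      intro x y hxy
      ext i
      exact congrFun hxy (Sum.inr i)
    have h3 : (LinearMap.ker P.mulVecLin).map f ≤
        Module.End.eigenspace (Matrix.toLin' H) (1 / (N : ℝ)) := by
      rintro _ ⟨v, hv, rfl⟩
      rw [Module.End.mem_eigenspace_iff, Matrix.toLin'_apply]
      exact hker v hv
    have h4 := Submodule.finrank_mono h3
    rw [← (Submodule.equivMapOfInjective f hf (LinearMap.ker P.mulVecLin)).finrank_eq] at h4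
    omega
end

section
/- Let N ≥ 1, let P be an N×N permutation matrix, and let Π = (1/N) P. Then the characteristic polynomial of the H-matrix H(Π) ∈ ℝ^{2N×2N} is x^N (x − 2/N)^N; equivalently, the eigenvalues of H(Π) are 0 with multiplicity N and 2/N with multiplicity N. -/
open Matrix Polynomial

/-- For `Π = (1/N) P` with `P` an `N×N` permutation matrix, the characteristic
polynomial of the H-matrix `H(Π)` is `x^N (x - 2/N)^N`. -/
theorem stmt11 (N : ℕ) (hN : 1 ≤ N) (σ : Equiv.Perm (Fin N)) :
    let P : Matrix (Fin N) (Fin N) ℝ := ((N : ℝ)⁻¹) • σ.permMatrix ℝ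
    let H : Matrix (Fin N ⊕ Fin N) (Fin N ⊕ Fin N) ℝ :=
      Matrix.fromBlocks (Matrix.diagonal (P *ᵥ 1)) P Pᵀ (Matrix.diagonal (Pᵀ *ᵥ 1))
    H.charpoly = Polynomial.X ^ N * (Polynomial.X - Polynomial.C (2 / (N : ℝ))) ^ N := by
  intro P H
  set c : ℝ := (N : ℝ)⁻¹ with hc
  set Q : Matrix (Fin N) (Fin N) ℝ := σ.permMatrix ℝ with hQ
  have hQt : Qᵀ = σ⁻¹.permMatrix ℝ := by rw [hQ, Matrix.transpose_permMatrix]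
  have h1 : Q * Qᵀ = 1 := by
    rw [hQt, hQ, ← Matrix.permMatrix_mul]; simp
  have h2 : Qᵀ * Q = 1 := mul_eq_one_comm.mp h1
  have hP : P = c • Q := rfl
  have e1 : P *ᵥ 1 = fun _ => c := by
    ext i
    simp [P, hc, Matrix.smul_mulVec, Matrix.permMatrix_mulVec]
  have e2 : Pᵀ *ᵥ 1 = fun _ => c := by
    ext i
    simp [P, hc, Matrix.smul_mulVec, Matrix.permMatrix_mulVec]
  let A : Matrix (Fin N ⊕ Fin N) (Fin N) ℝ :=
    Matrix.fromRows (c • (1 : Matrix (Fin N) (Fin N) ℝ)) (c • Qᵀ)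
  let B : Matrix (Fin N) (Fin N ⊕ Fin N) ℝ :=
    Matrix.fromCols (1 : Matrix (Fin N) (Fin N) ℝ) Q
  have hH : H = A * B := by
    simp only [H, A, B]
    rw [Matrix.fromRows_mul_fromCols, e1, e2, hP, Matrix.smul_mul, Matrix.smul_mul, Matrix.smul_mul,
      Matrix.smul_mul, h2, Matrix.one_mul, Matrix.one_mul, Matrix.mul_one,
      Matrix.transpose_smul, Matrix.smul_one_eq_diagonal]
  have hBA : B * A = Matrix.diagonal (fun _ => 2 / (N : ℝ)) := by
    simp only [A, B]
    rw [Matrix.fromCols_mul_fromRows, Matrix.mul_smul, Matrix.mul_smul, h1,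
      ← Matrix.smul_one_eq_diagonal, Matrix.one_mul, ← add_smul, hc]
    congr 1
    ring
  have key := Matrix.charpoly_mul_comm' A B
  rw [← hH, hBA, Matrix.charpoly_diagonal] at key
  simp only [Fintype.card_sum, Fintype.card_fin, Finset.prod_const, Finset.card_univ, pow_add,
    mul_assoc] at key
  exact mul_left_cancel₀ (pow_ne_zero N Polynomial.X_ne_zero) key
end

section
/- Let Π ∈ ℝ^{M×N} be a positive coupling matrix with uniform marginals. Then Π Πᵀ 1_M = (1/(MN)) 1_M, every eigenvalue of the symmetric positive semidefinite matrix Π Πᵀ is at most 1/(MN), and the eigenspace of Π Πᵀ for the eigenvalue 1/(MN) is one-dimensional, spanned by 1_M. Equivalently, the largest singular value of Π is σ₁ = 1/√(MN) and it is simple. -/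
open Matrix

lemma aux_identity {M : ℕ} (A : Matrix (Fin M) (Fin M) ℝ) (s lam : ℝ)
    (hsym : ∀ i k, A i k = A k i) (hs : ∀ i, ∑ k, A i k = s)
    (u : Fin M → ℝ) (hu : A *ᵥ u = lam • u) :
    ∑ i, ∑ k, A i k * (u i - u k) ^ 2 = 2 * (s - lam) * ∑ i, u i ^ 2 := by
  have h1 : ∑ i, ∑ k, A i k * u i ^ 2 = s * ∑ i, u i ^ 2 := by
    rw [Finset.mul_sum]
    refine Finset.sum_congr rfl fun i _ => ?_
    rw [← Finset.sum_mul, hs]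
  have h2 : ∑ i, ∑ k, A i k * u k ^ 2 = s * ∑ i, u i ^ 2 := by
    rw [Finset.sum_comm, ← h1]
    refine Finset.sum_congr rfl fun i _ => Finset.sum_congr rfl fun k _ => ?_
    rw [hsym]
  have h3 : ∑ i, ∑ k, u i * (A i k * u k) = lam * ∑ i, u i ^ 2 := by
    rw [Finset.mul_sum]
    refine Finset.sum_congr rfl fun i _ => ?_
    have h := congrFun hu i
    simp only [Matrix.mulVec, dotProduct, Pi.smul_apply, smul_eq_mul] at h
    rw [← Finset.mul_sum, h]
    ring
  have h4 : ∑ i, ∑ k, A i k * (u i - u k) ^ 2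
      = ∑ i, ∑ k, A i k * u i ^ 2 + ∑ i, ∑ k, A i k * u k ^ 2
        - 2 * ∑ i, ∑ k, u i * (A i k * u k) := by
    simp only [Finset.mul_sum, ← Finset.sum_add_distrib, ← Finset.sum_sub_distrib]
    refine Finset.sum_congr rfl fun i _ => Finset.sum_congr rfl fun k _ => ?_
    ring
  rw [h4, h1, h2, h3]
  ring

/-- For a positive coupling matrix `P` with uniform marginals, `P Pᵀ` fixes the
all-ones vector with eigenvalue `1/(MN)`, every eigenvalue of `P Pᵀ` is at most
`1/(MN)`, and the eigenspace for `1/(MN)` is spanned by the all-ones vector. -/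
theorem stmt12 (M N : ℕ) (P : Matrix (Fin M) (Fin N) ℝ)
    (hpos : ∀ i j, 0 < P i j)
    (hrow : P *ᵥ 1 = fun _ => 1 / (M : ℝ))
    (hcol : Pᵀ *ᵥ 1 = fun _ => 1 / (N : ℝ)) :
    ((P * Pᵀ) *ᵥ 1 = fun _ => 1 / ((M : ℝ) * (N : ℝ))) ∧
    (∀ (lam : ℝ) (u : Fin M → ℝ), u ≠ 0 →
      (P * Pᵀ) *ᵥ u = lam • u → lam ≤ 1 / ((M : ℝ) * (N : ℝ))) ∧
    (∀ u : Fin M → ℝ, (P * Pᵀ) *ᵥ u = (1 / ((M : ℝ) * (N : ℝ))) • u →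
      ∃ c : ℝ, u = c • (1 : Fin M → ℝ)) := by
  have hA1 : (P * Pᵀ) *ᵥ 1 = fun _ => 1 / ((M : ℝ) * (N : ℝ)) := by
    rw [← Matrix.mulVec_mulVec, hcol]
    funext i
    have h := congrFun hrow i
    simp only [Matrix.mulVec, dotProduct, Pi.one_apply, mul_one] at h ⊢
    rw [← Finset.sum_mul, h, one_div_mul_one_div]
  have hs : ∀ i, ∑ k, (P * Pᵀ) i k = 1 / ((M : ℝ) * (N : ℝ)) := by
    intro i
    have h := congrFun hA1 i
    simpa only [Matrix.mulVec, dotProduct, Pi.one_apply, mul_one] using h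
  have hsym : ∀ i k, (P * Pᵀ) i k = (P * Pᵀ) k i := by
    intro i k
    simp only [Matrix.mul_apply, Matrix.transpose_apply, mul_comm]
  have hApos : ∀ i k, 0 < (P * Pᵀ) i k := by
    intro i k
    have hN : (Finset.univ : Finset (Fin N)).Nonempty := by
      by_contra hne
      rw [Finset.not_nonempty_iff_eq_empty] at hne
      have h := congrFun hrow i
      simp only [Matrix.mulVec, dotProduct, hne, Finset.sum_empty] at h
      have hM : (0 : ℝ) < M := by exact_mod_cast i.pos
      have : 0 < 1 / (M : ℝ) := by positivity
      linarith
    simp only [Matrix.mul_apply, Matrix.transpose_apply]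
    exact Finset.sum_pos (fun j _ => mul_pos (hpos i j) (hpos k j)) hN
  have hterm : ∀ (u : Fin M → ℝ) (i k : Fin M), 0 ≤ (P * Pᵀ) i k * (u i - u k) ^ 2 :=
    fun u i k => mul_nonneg (hApos i k).le (sq_nonneg _)
  refine ⟨hA1, ?_, ?_⟩
  · intro lam u hu0 hu
    have hid := aux_identity _ _ lam hsym hs u hu
    have hnn : 0 ≤ ∑ i, ∑ k, (P * Pᵀ) i k * (u i - u k) ^ 2 :=
      Finset.sum_nonneg fun i _ => Finset.sum_nonneg fun k _ => hterm u i k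
    obtain ⟨i, hi⟩ := Function.ne_iff.mp hu0
    have hp : 0 < ∑ i, u i ^ 2 :=
      Finset.sum_pos' (fun i _ => sq_nonneg _) ⟨i, Finset.mem_univ _, sq_pos_of_ne_zero hi⟩
    rw [hid] at hnn
    have := nonneg_of_mul_nonneg_left hnn hp
    linarith
  · intro u hu
    have hid := aux_identity _ _ _ hsym hs u hu
    rw [sub_self, mul_zero, zero_mul] at hid
    have hall : ∀ i k, u i = u k := by
      intro i k
      have h1 := (Finset.sum_eq_zero_iff_of_nonneg
        (fun i _ => Finset.sum_nonneg fun k _ => hterm u i k)).mp hid i (Finset.mem_univ _)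
      have h2 := (Finset.sum_eq_zero_iff_of_nonneg
        (fun k _ => hterm u i k)).mp h1 k (Finset.mem_univ _)
      have h3 := (mul_eq_zero.mp h2).resolve_left (hApos i k).ne'
      exact sub_eq_zero.mp (pow_eq_zero_iff two_ne_zero |>.mp h3)
    rcases isEmpty_or_nonempty (Fin M) with he | ⟨⟨i0⟩⟩
    · exact ⟨0, Subsingleton.elim _ _⟩
    · refine ⟨u i0, ?_⟩
      funext i
      simp [hall i i0]
end

section
/- Let M, N ≥ 2 and let Π ∈ ℝ^{M×N} be a positive coupling matrix with uniform marginals. Let σ₁ ≥ σ₂ be the two largest singular values of Π (square roots of the two largest eigenvalues, counted with multiplicity, of Π Πᵀ), and let λ₁ ≥ λ₂ ≥ … ≥ λ_{M+N} be the eigenvalues of H(Π) in descending order with multiplicity. Then the condition number κ(H) = λ₁ / λ_{M+N−1} satisfies (M+N)² / ( 2 M² N² (σ₁² − σ₂²) ) ≤ κ(H) ≤ (M+N)² / ( M² N² (σ₁² − σ₂²) ). -/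
open Matrix Polynomial

lemma aux_charpoly (M N : ℕ) (P : Matrix (Fin M) (Fin N) ℝ) (a b : ℝ) :
    (X - C b) ^ M * (Matrix.fromBlocks (Matrix.diagonal (fun _ : Fin M => a)) P Pᵀ
          (Matrix.diagonal (fun _ : Fin N => b))).charpoly
      = (P * Pᵀ).charpoly.comp ((X - C a) * (X - C b)) * (X - C b) ^ N := by
  have h1 : (Matrix.fromBlocks (Matrix.diagonal (fun _ : Fin M => a)) P Pᵀ
          (Matrix.diagonal (fun _ : Fin N => b))).charmatrix
      * Matrix.fromBlocks (Matrix.diagonal (fun _ : Fin M => (X - C b : ℝ[X]))) 0 (Pᵀ.map C) 1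
      = Matrix.fromBlocks
        ((P * Pᵀ).charmatrix.map (Polynomial.compRingHom ((X - C a) * (X - C b)))) (-(P.map C))
        0 (Matrix.diagonal (fun _ : Fin N => (X - C b : ℝ[X]))) := by
    have h0 : (Matrix.fromBlocks (Matrix.diagonal (fun _ : Fin M => a)) P Pᵀ
          (Matrix.diagonal (fun _ : Fin N => b))).charmatrix
        = Matrix.fromBlocks (Matrix.diagonal (fun _ : Fin M => (X - C a : ℝ[X]))) (-(P.map C))
          (-(Pᵀ.map C)) (Matrix.diagonal (fun _ : Fin N => (X - C b : ℝ[X]))) := by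
      ext i j : 1
      rcases i with i | i <;> rcases j with j | j <;>
        simp [Matrix.charmatrix_apply, Matrix.diagonal_apply] <;> split_ifs <;> simp
    rw [h0, Matrix.fromBlocks_multiply]
    congr 1
    · ext i j : 1
      by_cases hij : i = j <;>
      simp [Matrix.charmatrix_apply, Matrix.diagonal_apply, Matrix.mul_apply, hij] <;> ring
    · simp
    · ext i j : 1
      simp [Matrix.mul_apply, Matrix.diagonal_apply, mul_comm]
    · simp
  have h2 := congrArg Matrix.det h1
  rw [Matrix.det_mul, Matrix.det_fromBlocks_zero₁₂, Matrix.det_fromBlocks_zero₂₁,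
    Matrix.det_diagonal, Matrix.det_diagonal, Matrix.det_one, mul_one, Finset.prod_const,
    Finset.prod_const] at h2
  have h3 : ((P * Pᵀ).charmatrix.map (Polynomial.compRingHom ((X - C a) * (X - C b)))).det
      = (P * Pᵀ).charpoly.comp ((X - C a) * (X - C b)) := by
    have := RingHom.map_det (Polynomial.compRingHom ((X - C a) * (X - C b))) (P * Pᵀ).charmatrix
    rw [RingHom.mapMatrix_apply] at this
    rw [← this]
    rfl
  rw [h3] at h2
  simp only [Finset.card_univ, Fintype.card_fin] at h2
  rw [← h2, mul_comm]
  rfl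

lemma aux_sigma (M N : ℕ) (hM : 2 ≤ M)
    (P : Matrix (Fin M) (Fin N) ℝ) (a b : ℝ)
    (hpos : ∀ i j, 0 < P i j)
    (hrow : P *ᵥ 1 = fun _ => a)
    (hcol : Pᵀ *ᵥ 1 = fun _ => b)
    (σ : Fin M → ℝ) (hσa : Antitone σ) (hσ0 : ∀ i, 0 ≤ σ i)
    (hσchar : (P * Pᵀ).charpoly = ∏ i, (Polynomial.X - Polynomial.C (σ i ^ 2))) :
    σ ⟨0, by omega⟩ ^ 2 = a * b := by
  have hone : (P * Pᵀ) *ᵥ 1 = fun _ => a * b := by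
    rw [← Matrix.mulVec_mulVec, hcol]
    have : (fun _ : Fin N => b) = b • (1 : Fin N → ℝ) := by ext; simp
    rw [this, Matrix.mulVec_smul, hrow]
    ext; simp [mul_comm]
  apply le_antisymm
  · have hroot : (P * Pᵀ).charpoly.IsRoot (σ ⟨0, by omega⟩ ^ 2) := by
      rw [hσchar, Polynomial.IsRoot, Polynomial.eval_prod]
      apply Finset.prod_eq_zero (Finset.mem_univ ⟨0, by omega⟩)
      simp
    rw [← Matrix.charpoly_toLin', ← Module.End.hasEigenvalue_iff_isRoot_charpoly] at hroot
    obtain ⟨k, hk⟩ := eigenvalue_mem_ball hroot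
    have hk' := hone
    have := congrFun hone k
    simp only [Matrix.mulVec, dotProduct, Pi.one_apply, mul_one] at this
    rw [← Finset.add_sum_erase _ _ (Finset.mem_univ k)] at this
    rw [Metric.mem_closedBall, Real.dist_eq] at hk
    have h2 : ∑ j ∈ Finset.univ.erase k, ‖(P * Pᵀ) k j‖
        = ∑ j ∈ Finset.univ.erase k, (P * Pᵀ) k j := by
      apply Finset.sum_congr rfl
      intro j _
      rw [Real.norm_of_nonneg]
      rw [Matrix.mul_apply]
      exact Finset.sum_nonneg fun l _ => mul_nonneg (hpos _ _).le (hpos _ _).le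
    rw [h2] at hk
    linarith [le_abs_self (σ ⟨0, by omega⟩ ^ 2 - (P * Pᵀ) k k)]
  · have hroot : (P * Pᵀ).charpoly.IsRoot (a * b) := by
      rw [← Matrix.charpoly_toLin', ← Module.End.hasEigenvalue_iff_isRoot_charpoly]
      apply Module.End.hasEigenvalue_of_hasEigenvector (x := 1)
      rw [Module.End.hasEigenvector_iff, Module.End.mem_eigenspace_iff]
      constructor
      · rw [Matrix.toLin'_apply, hone]; ext; simp
      · intro h
        have := congrFun h ⟨0, by omega⟩
        simp at this
    rw [hσchar, Polynomial.IsRoot, Polynomial.eval_prod, Finset.prod_eq_zero_iff] at hroot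
    obtain ⟨i, -, hi⟩ := hroot
    simp only [eval_sub, eval_X, eval_C] at hi
    have h1 : σ i ≤ σ ⟨0, by omega⟩ := hσa (Fin.mk_le_of_le_val (Nat.zero_le _))
    have := pow_le_pow_left₀ (hσ0 i) h1 2
    linarith

theorem stmt13 (M N : ℕ) (hM : 2 ≤ M) (hN : 2 ≤ N)
    (P : Matrix (Fin M) (Fin N) ℝ)
    (hpos : ∀ i j, 0 < P i j)
    (hrow : P *ᵥ 1 = fun _ => 1 / (M : ℝ))
    (hcol : Pᵀ *ᵥ 1 = fun _ => 1 / (N : ℝ))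
    (σ : Fin M → ℝ) (hσa : Antitone σ) (hσ0 : ∀ i, 0 ≤ σ i)
    (hσchar : (P * Pᵀ).charpoly = ∏ i, (Polynomial.X - Polynomial.C (σ i ^ 2)))
    (lam : Fin (M + N) → ℝ) (hlama : Antitone lam)
    (hlamchar :
      (Matrix.fromBlocks (Matrix.diagonal (P *ᵥ 1)) P Pᵀ
          (Matrix.diagonal (Pᵀ *ᵥ 1))).charpoly
        = ∏ i, (Polynomial.X - Polynomial.C (lam i))) :
    let σ₁ := σ ⟨0, by omega⟩
    let σ₂ := σ ⟨1, by omega⟩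
    let κ := lam ⟨0, by omega⟩ / lam ⟨M + N - 2, by omega⟩
    ((M : ℝ) + N) ^ 2 / (2 * (M : ℝ) ^ 2 * (N : ℝ) ^ 2 * (σ₁ ^ 2 - σ₂ ^ 2)) ≤ κ ∧
    κ ≤ ((M : ℝ) + N) ^ 2 / ((M : ℝ) ^ 2 * (N : ℝ) ^ 2 * (σ₁ ^ 2 - σ₂ ^ 2)) := by
  intro σ₁ σ₂ κ
  have hM0 : (0 : ℝ) < M := by positivity
  have hN0 : (0 : ℝ) < N := by positivity
  obtain ⟨a, ha⟩ : ∃ a : ℝ, a = 1 / M := ⟨_, rfl⟩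
  obtain ⟨b, hb⟩ : ∃ b : ℝ, b = 1 / N := ⟨_, rfl⟩
  have ha0 : 0 < a := by rw [ha]; positivity
  have hb0 : 0 < b := by rw [hb]; positivity
  rw [← ha] at hrow
  rw [← hb] at hcol
  have hs1 : σ₁ ^ 2 = a * b := aux_sigma M N hM P a b hpos hrow hcol σ hσa hσ0 hσchar
  have hle1 : ∀ i, σ i ^ 2 ≤ a * b := fun i => by
    rw [← hs1]
    exact pow_le_pow_left₀ (hσ0 i) (hσa (Fin.mk_le_of_le_val (Nat.zero_le _))) 2
  have key := aux_charpoly M N P a b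
  rw [hrow, hcol] at hlamchar
  rw [hlamchar, hσchar] at key
  -- the square roots
  let s : Fin M → ℝ := fun i => √((a - b) ^ 2 + 4 * σ i ^ 2)
  have hs0 : ∀ i, 0 ≤ s i := fun i => Real.sqrt_nonneg _
  have hssq : ∀ i, s i ^ 2 = (a - b) ^ 2 + 4 * σ i ^ 2 := fun i => Real.sq_sqrt (by positivity)
  have hsle : ∀ i, s i ≤ a + b := fun i => by
    apply abs_le_of_sq_le_sq' _ (by positivity) |>.2
    rw [hssq]; nlinarith [hle1 i]
  have hsab : ∀ i, |a - b| ≤ s i := fun i => by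
    apply Real.abs_le_sqrt
    nlinarith [sq_nonneg (σ i)]
  have hsanti : Antitone s := fun i j hij => by
    apply Real.sqrt_le_sqrt
    have := pow_le_pow_left₀ (hσ0 j) (hσa hij) 2
    linarith
  let xm : Fin M → ℝ := fun i => (a + b - s i) / 2
  let xp : Fin M → ℝ := fun i => (a + b + s i) / 2
  have key2 : (X - C b) ^ M * ∏ i, (X - C (lam i))
      = (∏ i, (X - C (xm i))) * (∏ i, (X - C (xp i))) * (X - C b) ^ N := by
    rw [key, Polynomial.prod_comp, ← Finset.prod_mul_distrib]
    congr 1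
    apply Finset.prod_congr rfl
    intro i _
    have e1 : xm i + xp i = a + b := by simp only [xm, xp]; ring
    have e2 : xm i * xp i = a * b - σ i ^ 2 := by
      simp only [xm, xp]; linear_combination -(hssq i) / 4
    have e1' := congrArg (C : ℝ → ℝ[X]) e1
    have e2' := congrArg (C : ℝ → ℝ[X]) e2
    simp only [C_add, C_mul, C_sub] at e1' e2'
    simp only [sub_comp, X_comp, C_comp]
    linear_combination X * e1' - e2'
  have hroots := congrArg Polynomial.roots key2
  have hpm : ∀ (n : ℕ) (f : Fin n → ℝ), (∏ i, (X - C (f i))) ≠ 0 := fun n f =>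
    (Polynomial.monic_prod_X_sub_C f Finset.univ).ne_zero
  have hpb : ∀ n : ℕ, (X - C b) ^ n ≠ 0 := fun n => pow_ne_zero _ (X_sub_C_ne_zero b)
  rw [Polynomial.roots_mul (mul_ne_zero (hpb _) (hpm _ _)),
    Polynomial.roots_mul (mul_ne_zero (mul_ne_zero (hpm _ _) (hpm _ _)) (hpb _)),
    Polynomial.roots_mul (mul_ne_zero (hpm _ _) (hpm _ _)),
    Polynomial.roots_pow, Polynomial.roots_pow, Polynomial.roots_X_sub_C] at hroots
  have hrp : ∀ (n : ℕ) (f : Fin n → ℝ), (∏ i, (X - C (f i))).roots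
      = Multiset.map f Finset.univ.val := fun n f => by
    have := Polynomial.roots_multiset_prod_X_sub_C (Multiset.map f Finset.univ.val)
    rw [Multiset.map_map] at this
    exact this
  simp only [hrp] at hroots
  have hcount : ∀ (p : ℝ → Prop) [DecidablePred p],
      M * (if p b then 1 else 0) + (Finset.univ.filter fun i => p (lam i)).card
      = (Finset.univ.filter fun i => p (xm i)).card
        + (Finset.univ.filter fun i => p (xp i)).card + N * (if p b then 1 else 0) := by
    intro p _
    have h := congrArg (Multiset.countP p) hroots
    simp only [Multiset.countP_add, Multiset.countP_nsmul, Multiset.countP_map] at h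
    have hc : Multiset.countP p {b} = if p b then 1 else 0 := by
      rw [← Multiset.cons_zero, Multiset.countP_cons]; simp
    rw [hc] at h
    exact h
  let m : ℝ := xm ⟨1, by omega⟩
  have hmb : m ≤ b := by
    have := hsab ⟨1, by omega⟩
    have := le_abs_self (a - b)
    simp only [m, xm]; linarith
  have hma : m ≤ a := by
    have := hsab ⟨1, by omega⟩
    have := neg_abs_le (a - b)
    simp only [m, xm]; linarith
  have hm0 : 0 ≤ m := by
    have := hsle ⟨1, by omega⟩
    simp only [m, xm]; linarith
  have hmab : 2 * m ≤ a + b := by linarith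
  have hmprod : m * (a + b - m) = σ₁ ^ 2 - σ₂ ^ 2 := by
    rw [hs1]
    have := hssq ⟨1, by omega⟩
    simp only [m, xm, σ₂]; linear_combination -this / 4
  have hxpb : ∀ i, a ≤ xp i ∧ b ≤ xp i := fun i => by
    have := hsab i
    have := neg_abs_le (a - b)
    have := le_abs_self (a - b)
    simp only [xp]; constructor <;> linarith
  -- largest eigenvalue
  have hs1' : s ⟨0, by omega⟩ = a + b := by
    have h := hssq ⟨0, by omega⟩
    have h' : σ ⟨0, by omega⟩ ^ 2 = a * b := hs1
    rw [h'] at h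
    exact (pow_left_inj₀ (hs0 _) (by positivity) two_ne_zero).1 (by rw [h]; ring)
  have hlam0 : lam ⟨0, by omega⟩ = a + b := by
    apply le_antisymm
    · by_contra hcon
      push Not at hcon
      have h := hcount (fun x => a + b < x)
      have h1 : (Finset.univ.filter fun i => a + b < xm i).card = 0 := by
        rw [Finset.card_eq_zero, Finset.filter_eq_empty_iff]
        intro i _
        have := hs0 i
        simp only [xm]; linarith
      have h2 : (Finset.univ.filter fun i => a + b < xp i).card = 0 := by
        rw [Finset.card_eq_zero, Finset.filter_eq_empty_iff]
        intro i _
        have := hsle i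
        simp only [xp]; linarith
      have h3 : 0 < (Finset.univ.filter fun i => a + b < lam i).card :=
        Finset.card_pos.2 ⟨⟨0, by omega⟩, by simpa using hcon⟩
      rw [h1, h2, if_neg (by linarith)] at h
      omega
    · have h := hcount (fun x => a + b ≤ x)
      have h2 : 0 < (Finset.univ.filter fun i => a + b ≤ xp i).card :=
        Finset.card_pos.2 ⟨⟨0, by omega⟩, by
          simp only [xp, Finset.mem_filter, Finset.mem_univ, true_and, hs1']; linarith⟩
      rw [if_neg (by linarith)] at h
      have h3 : 0 < (Finset.univ.filter fun i => a + b ≤ lam i).card := by omega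
      obtain ⟨i, hi⟩ := Finset.card_pos.1 h3
      exact (Finset.mem_filter.1 hi).2.trans (hlama (Fin.mk_le_of_le_val (Nat.zero_le _)))
  have hlam2 : lam ⟨M + N - 2, by omega⟩ = m := by
    apply le_antisymm
    · by_contra hcon
      push Not at hcon
      have h := hcount (fun x => x ≤ m)
      have h1 : 2 ≤ (Finset.univ.filter fun i => xm i ≤ m).card := by
        have hsub : ({⟨0, by omega⟩, ⟨1, by omega⟩} : Finset (Fin M))
            ⊆ Finset.univ.filter fun i => xm i ≤ m := by
          intro i hi
          simp only [Finset.mem_insert, Finset.mem_singleton] at hi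
          rw [Finset.mem_filter]
          refine ⟨Finset.mem_univ _, ?_⟩
          rcases hi with rfl | rfl
          · simp only [xm, hs1']; linarith
          · exact le_refl _
        have := Finset.card_le_card hsub
        rwa [Finset.card_pair (by simp)] at this
      have h2 : 2 ≤ (Finset.univ.filter fun i => lam i ≤ m).card := by
        by_cases hbm : b ≤ m
        · have hba : b ≤ a := hbm.trans hma
          have hMN : M ≤ N := by
            rw [ha, hb] at hba
            have := (one_div_le_one_div hN0 hM0).1 hba
            exact_mod_cast this
          rw [if_pos hbm] at h
          omega
        · rw [if_neg hbm] at h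
          omega
      have h3 : (Finset.univ.filter fun i => lam i ≤ m) ⊆ {⟨M + N - 1, by omega⟩} := by
        intro i hi
        have hi' := (Finset.mem_filter.1 hi).2
        rw [Finset.mem_singleton]
        by_contra hne
        have : i ≤ ⟨M + N - 2, by omega⟩ := by
          rw [Fin.le_def]
          have : (i : ℕ) ≠ M + N - 1 := fun h => hne (Fin.ext h)
          have := i.2
          simp only
          omega
        linarith [hlama this]
      have := Finset.card_le_card h3
      rw [Finset.card_singleton] at this
      omega
    · by_contra hcon
      push Not at hcon
      have h := hcount (fun x => x < m)
      have h1 : (Finset.univ.filter fun i => xm i < m) ⊆ {⟨0, by omega⟩} := by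
        intro i hi
        have hi' := (Finset.mem_filter.1 hi).2
        rw [Finset.mem_singleton]
        by_contra hne
        have : (⟨1, by omega⟩ : Fin M) ≤ i := by
          rw [Fin.le_def]
          have : (i : ℕ) ≠ 0 := fun h => hne (Fin.ext h)
          simp only
          omega
        have := hsanti this
        simp only [m, xm] at hi'
        linarith
      have h1' := Finset.card_le_card h1
      rw [Finset.card_singleton] at h1'
      have h2 : (Finset.univ.filter fun i => xp i < m).card = 0 := by
        rw [Finset.card_eq_zero, Finset.filter_eq_empty_iff]
        intro i _
        have := (hxpb i).1
        linarith
      have h3 : 2 ≤ (Finset.univ.filter fun i => lam i < m).card := by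
        have hsub : ({⟨M + N - 2, by omega⟩, ⟨M + N - 1, by omega⟩} : Finset (Fin (M + N)))
            ⊆ Finset.univ.filter fun i => lam i < m := by
          intro i hi
          simp only [Finset.mem_insert, Finset.mem_singleton] at hi
          rw [Finset.mem_filter]
          refine ⟨Finset.mem_univ _, ?_⟩
          rcases hi with rfl | rfl
          · exact hcon
          · refine lt_of_le_of_lt (hlama ?_) hcon
            rw [Fin.le_def]
            simp only
            omega
        have := Finset.card_le_card hsub
        rwa [Finset.card_pair (by rw [Ne, Fin.ext_iff]; simp only; omega)] at this
      rw [h2, if_neg (by linarith)] at h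
      omega
  have hκ : κ = (a + b) / m := by simp only [κ, hlam0, hlam2]
  rw [hκ, ← hmprod]
  have hab : (a + b) * (M * N) = M + N := by rw [ha, hb]; field_simp; ring
  rw [← hab]
  rcases hm0.eq_or_lt with hm | hm
  · rw [← hm]; simp
  have hd : 0 < a + b - m := by linarith
  constructor
  · rw [div_le_div_iff₀ (by positivity) hm]
    have : 0 ≤ (a + b) * M ^ 2 * N ^ 2 * m * (a + b - 2 * m) := by
      have : 0 ≤ a + b - 2 * m := by linarith
      positivity
    nlinarith
  · rw [div_le_div_iff₀ hm (by positivity)]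
    have : 0 ≤ (a + b) * M ^ 2 * N ^ 2 * m * m := by positivity
    nlinarith
end

section
/- Let Π, Π* ∈ ℝ^{M×N} be two coupling matrices and set A = Π − Π*. Suppose max_i |Σ_{j} A_{ij}| ≤ δ₁, max_j |Σ_{i} A_{ij}| ≤ δ₁, and Σ_{i,j} A_{ij}² ≤ δ₂². Let λ₁(H) ≥ … ≥ λ_{M+N}(H) denote the eigenvalues of a symmetric matrix H in descending order with multiplicity. Then for every 1 ≤ k ≤ M+N, |λ_k(H(Π)) − λ_k(H(Π*))| ≤ δ₁ + δ₂. -/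
open Matrix Polynomial

lemma aux_basis {n : Type*} [Fintype n] [DecidableEq n] {A : Matrix n n ℝ} (hA : A.IsHermitian)
    {m : ℕ} (hm : Fintype.card n = m) (lam : Fin m → ℝ) (hl : Antitone lam)
    (hc : A.charpoly = ∏ i, (Polynomial.X - Polynomial.C (lam i))) :
    ∃ b : OrthonormalBasis (Fin m) ℝ (EuclideanSpace ℝ n),
      ∀ i, A *ᵥ (b i).ofLp = lam i • (b i).ofLp := by
  subst hm
  have h0 : hA.eigenvalues₀ = lam := by
    rw [← List.ofFn_inj, ← hA.sort_roots_charpoly_eq_eigenvalues₀, hc]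
    have hr : (∏ i, (Polynomial.X - Polynomial.C (lam i))).roots
        = Multiset.map lam Finset.univ.val := by
      rw [← Polynomial.roots_multiset_prod_X_sub_C (Multiset.map lam Finset.univ.val)]
      rw [Multiset.map_map]
      rfl
    rw [hr]
    simp_rw [Fin.univ_val_map, Multiset.map_coe, List.map_ofFn]
    simp only [Multiset.coe_sort]
    exact List.mergeSort_eq_self _ (by simpa using hl.sortedGE_ofFn.pairwise)
  let e : Fin (Fintype.card n) ≃ n := Fintype.equivOfCardEq (Fintype.card_fin _)
  refine ⟨hA.eigenvectorBasis.reindex e.symm, fun i => ?_⟩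
  have := hA.mulVec_eigenvectorBasis (e i)
  simp only [OrthonormalBasis.reindex_apply, Equiv.symm_symm]
  rw [this, ← h0]
  simp [Matrix.IsHermitian.eigenvalues, e]

lemma aux_quad {n : Type*} [Fintype n] [DecidableEq n] {A : Matrix n n ℝ}
    {m : ℕ} (lam : Fin m → ℝ) (b : OrthonormalBasis (Fin m) ℝ (EuclideanSpace ℝ n))
    (hb : ∀ i, A *ᵥ (b i).ofLp = lam i • (b i).ofLp) (x : EuclideanSpace ℝ n) :
    x.ofLp ⬝ᵥ (A *ᵥ x.ofLp) = ∑ i, lam i * (inner ℝ (b i) x) ^ 2 := by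
  have h1 : A *ᵥ x.ofLp = ∑ i, (inner ℝ (b i) x * lam i) • (b i).ofLp := by
    conv_lhs => rw [← b.sum_repr' x]
    rw [WithLp.ofLp_sum, Matrix.mulVec_sum]
    refine Finset.sum_congr rfl fun i _ => ?_
    rw [WithLp.ofLp_smul, Matrix.mulVec_smul, hb, smul_smul]
  rw [h1, dotProduct_sum]
  refine Finset.sum_congr rfl fun i _ => ?_
  rw [dotProduct_smul]
  have : x.ofLp ⬝ᵥ (b i).ofLp = inner ℝ (b i) x := by
    simp [EuclideanSpace.inner_eq_star_dotProduct]
  rw [this, smul_eq_mul]; ring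

lemma aux_norm {n : Type*} [Fintype n] 
    {m : ℕ} (b : OrthonormalBasis (Fin m) ℝ (EuclideanSpace ℝ n)) (x : EuclideanSpace ℝ n) :
    ‖x‖ ^ 2 = ∑ i, (inner ℝ (b i) x) ^ 2 := by
  rw [← b.sum_sq_norm_inner_right x]
  simp

lemma aux_weyl {n : Type*} [Fintype n] [DecidableEq n] {A B : Matrix n n ℝ}
    {m : ℕ} (lam mu : Fin m → ℝ) (hl : Antitone lam) (hmu : Antitone mu)
    (b b' : OrthonormalBasis (Fin m) ℝ (EuclideanSpace ℝ n))
    (hb : ∀ i, A *ᵥ (b i).ofLp = lam i • (b i).ofLp)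
    (hb' : ∀ i, B *ᵥ (b' i).ofLp = mu i • (b' i).ofLp) (c : ℝ)
    (h : ∀ x : EuclideanSpace ℝ n,
      x.ofLp ⬝ᵥ (A *ᵥ x.ofLp) ≤ x.ofLp ⬝ᵥ (B *ᵥ x.ofLp) + c * ‖x‖ ^ 2) (k : Fin m) :
    lam k ≤ mu k + c := by
  let φ : EuclideanSpace ℝ n →ₗ[ℝ] ({i : Fin m // i ≠ k} → ℝ) :=
    LinearMap.pi fun i => if k < i.1 then (innerSL ℝ (b i)).toLinearMap
      else (innerSL ℝ (b' i)).toLinearMap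
  have hk : LinearMap.ker φ ≠ ⊥ := by
    apply LinearMap.ker_ne_bot_of_finrank_lt
    rw [Module.finrank_eq_card_basis b.toBasis, Module.finrank_fintype_fun_eq_card]
    exact Fintype.card_subtype_lt (x := k) (by simp)
  obtain ⟨x, hx, hx0⟩ := Submodule.exists_mem_ne_zero_of_ne_bot hk
  have hφ : ∀ i (hi : i ≠ k), φ x ⟨i, hi⟩ = 0 := fun i hi => by
    rw [LinearMap.mem_ker.1 hx]; rfl
  have hgt : ∀ i, k < i → inner ℝ (b i) x = 0 := fun i hi => by
    have := hφ i hi.ne'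
    simpa [φ, hi] using this
  have hlt : ∀ i, i < k → inner ℝ (b' i) x = 0 := fun i hi => by
    have := hφ i hi.ne
    simpa [φ, hi.not_gt] using this
  have hA : lam k * ‖x‖ ^ 2 ≤ x.ofLp ⬝ᵥ (A *ᵥ x.ofLp) := by
    rw [aux_quad lam b hb, aux_norm b, Finset.mul_sum]
    refine Finset.sum_le_sum fun i _ => ?_
    rcases lt_or_ge k i with hi | hi
    · simp [hgt i hi]
    · exact mul_le_mul_of_nonneg_right (hl hi) (sq_nonneg _)
  have hB : x.ofLp ⬝ᵥ (B *ᵥ x.ofLp) ≤ mu k * ‖x‖ ^ 2 := by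
    rw [aux_quad mu b' hb', aux_norm b', Finset.mul_sum]
    refine Finset.sum_le_sum fun i _ => ?_
    rcases lt_or_ge i k with hi | hi
    · simp [hlt i hi]
    · exact mul_le_mul_of_nonneg_right (hmu hi) (sq_nonneg _)
  have hpos : 0 < ‖x‖ ^ 2 := by positivity
  have := h x
  refine le_of_mul_le_mul_right ?_ hpos
  linarith

lemma aux_form {M N : ℕ} (P : Matrix (Fin M) (Fin N) ℝ) (x : Fin M ⊕ Fin N → ℝ) :
    x ⬝ᵥ ((Matrix.fromBlocks (Matrix.diagonal (P *ᵥ 1)) P Pᵀ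
        (Matrix.diagonal (Pᵀ *ᵥ 1))) *ᵥ x) =
      ∑ i, (∑ j, P i j) * x (Sum.inl i) ^ 2 + ∑ j, (∑ i, P i j) * x (Sum.inr j) ^ 2
        + 2 * ∑ i, ∑ j, P i j * (x (Sum.inl i) * x (Sum.inr j)) := by
  rw [Matrix.fromBlocks_mulVec]
  simp only [dotProduct, Fintype.sum_sum_type, Sum.elim_inl, Sum.elim_inr, Pi.add_apply,
    Matrix.mulVec_diagonal, mul_add, Finset.sum_add_distrib, Matrix.mulVec, Function.comp,
    Matrix.transpose_apply, Pi.one_apply, mul_one, Finset.mul_sum, Matrix.diagonal_apply,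
    ite_mul, zero_mul, mul_ite, mul_zero, Finset.sum_ite_eq, Finset.mem_univ, if_true,
    Finset.sum_mul]
  rw [Finset.sum_comm (f := fun (j : Fin N) (i : Fin M) =>
    x (Sum.inr j) * (P i j * x (Sum.inl i)))]
  have e1 : ∀ i j, 2 * (P i j * (x (Sum.inl i) * x (Sum.inr j))) =
      x (Sum.inl i) * (P i j * x (Sum.inr j)) + x (Sum.inr j) * (P i j * x (Sum.inl i)) := by
    intros; ring
  simp only [e1, Finset.sum_add_distrib]
  have e2 : ∀ (p y : ℝ), y * (p * y) = p * y ^ 2 := by intros; ring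
  simp only [e2]
  ring

lemma aux_bound {M N : ℕ} (P Q : Matrix (Fin M) (Fin N) ℝ)
    (δ₁ δ₂ : ℝ) (hδ₂ : 0 ≤ δ₂)
    (h1 : ∀ i, |∑ j, (P i j - Q i j)| ≤ δ₁)
    (h2 : ∀ j, |∑ i, (P i j - Q i j)| ≤ δ₁)
    (h3 : ∑ i, ∑ j, (P i j - Q i j) ^ 2 ≤ δ₂ ^ 2)
    (x : EuclideanSpace ℝ (Fin M ⊕ Fin N)) :
    x.ofLp ⬝ᵥ ((Matrix.fromBlocks (Matrix.diagonal (P *ᵥ 1)) P Pᵀ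
        (Matrix.diagonal (Pᵀ *ᵥ 1))) *ᵥ x.ofLp) ≤
    x.ofLp ⬝ᵥ ((Matrix.fromBlocks (Matrix.diagonal (Q *ᵥ 1)) Q Qᵀ
        (Matrix.diagonal (Qᵀ *ᵥ 1))) *ᵥ x.ofLp) + (δ₁ + δ₂) * ‖x‖ ^ 2 := by
  rw [aux_form, aux_form, EuclideanSpace.real_norm_sq_eq, Fintype.sum_sum_type]
  set u : Fin M → ℝ := fun i => x (Sum.inl i)
  set v : Fin N → ℝ := fun j => x (Sum.inr j)
  change ∑ i, (∑ j, P i j) * u i ^ 2 + ∑ j, (∑ i, P i j) * v j ^ 2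
        + 2 * ∑ i, ∑ j, P i j * (u i * v j) ≤ ∑ i, (∑ j, Q i j) * u i ^ 2 +
        ∑ j, (∑ i, Q i j) * v j ^ 2 + 2 * ∑ i, ∑ j, Q i j * (u i * v j)
        + (δ₁ + δ₂) * (∑ i, u i ^ 2 + ∑ j, v j ^ 2)
  have a1 : ∑ i, (∑ j, P i j) * u i ^ 2 - ∑ i, (∑ j, Q i j) * u i ^ 2 ≤ δ₁ * ∑ i, u i ^ 2 := by
    rw [← Finset.sum_sub_distrib, Finset.mul_sum]
    refine Finset.sum_le_sum fun i _ => ?_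
    rw [← sub_mul, ← Finset.sum_sub_distrib]
    exact mul_le_mul_of_nonneg_right ((le_abs_self _).trans (h1 i)) (sq_nonneg _)
  have a2 : ∑ j, (∑ i, P i j) * v j ^ 2 - ∑ j, (∑ i, Q i j) * v j ^ 2 ≤ δ₁ * ∑ j, v j ^ 2 := by
    rw [← Finset.sum_sub_distrib, Finset.mul_sum]
    refine Finset.sum_le_sum fun i _ => ?_
    rw [← sub_mul, ← Finset.sum_sub_distrib]
    exact mul_le_mul_of_nonneg_right ((le_abs_self _).trans (h2 i)) (sq_nonneg _)
  set U := ∑ i, u i ^ 2 with hU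
  set V := ∑ j, v j ^ 2 with hV
  have hU0 : 0 ≤ U := Finset.sum_nonneg fun i _ => sq_nonneg _
  have hV0 : 0 ≤ V := Finset.sum_nonneg fun i _ => sq_nonneg _
  have a3 : ∑ i, ∑ j, P i j * (u i * v j) - ∑ i, ∑ j, Q i j * (u i * v j)
      = ∑ p : Fin M × Fin N, (P p.1 p.2 - Q p.1 p.2) * (u p.1 * v p.2) := by
    rw [Fintype.sum_prod_type]
    simp only [sub_mul, Finset.sum_sub_distrib]
  have a4 := Finset.sum_mul_sq_le_sq_mul_sq (Finset.univ : Finset (Fin M × Fin N))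
    (fun p => P p.1 p.2 - Q p.1 p.2) (fun p => u p.1 * v p.2)
  have a5 : ∑ p : Fin M × Fin N, (u p.1 * v p.2) ^ 2 = U * V := by
    rw [Fintype.sum_prod_type, hU, hV, Finset.sum_mul_sum]
    simp only [mul_pow]
  rw [a5, Fintype.sum_prod_type (f := fun p : Fin M × Fin N => (P p.1 p.2 - Q p.1 p.2) ^ 2),
    ← a3] at a4
  set S := ∑ i, ∑ j, P i j * (u i * v j) - ∑ i, ∑ j, Q i j * (u i * v j) with hS
  have a6 : S ^ 2 ≤ (δ₂ * ((U + V) / 2)) ^ 2 := by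
    refine a4.trans ((mul_le_mul_of_nonneg_right h3 (mul_nonneg hU0 hV0)).trans ?_)
    rw [mul_pow]
    refine mul_le_mul_of_nonneg_left ?_ (sq_nonneg _)
    nlinarith [sq_nonneg (U - V)]
  have a7 := (abs_le_of_sq_le_sq' a6 (by positivity)).2
  nlinarith

lemma aux_herm {M N : ℕ} (P : Matrix (Fin M) (Fin N) ℝ) :
    (Matrix.fromBlocks (Matrix.diagonal (P *ᵥ 1)) P Pᵀ
        (Matrix.diagonal (Pᵀ *ᵥ 1))).IsHermitian := by
  refine Matrix.IsHermitian.fromBlocks (Matrix.isHermitian_diagonal _) ?_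
    (Matrix.isHermitian_diagonal _)
  simp [Matrix.conjTranspose_eq_transpose_of_trivial]

/-- Weyl-type perturbation bound: if two coupling matrices `P` and `Pstar` differ
by `A = P - Pstar` with row/column sums bounded by `δ₁` and Frobenius norm bounded
by `δ₂`, then the corresponding (descending) eigenvalues of their H-matrices differ
by at most `δ₁ + δ₂`. -/
theorem stmt16 (M N : ℕ) (P Pstar : Matrix (Fin M) (Fin N) ℝ)
    (hP0 : ∀ i j, 0 ≤ P i j) (hPr : ∀ i, 0 < ∑ j, P i j) (hPc : ∀ j, 0 < ∑ i, P i j)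
    (hPs : ∑ i, ∑ j, P i j = 1)
    (hQ0 : ∀ i j, 0 ≤ Pstar i j) (hQr : ∀ i, 0 < ∑ j, Pstar i j)
    (hQc : ∀ j, 0 < ∑ i, Pstar i j)
    (hQs : ∑ i, ∑ j, Pstar i j = 1)
    (δ₁ δ₂ : ℝ) (hδ₂ : 0 ≤ δ₂)
    (h1 : ∀ i, |∑ j, (P i j - Pstar i j)| ≤ δ₁)
    (h2 : ∀ j, |∑ i, (P i j - Pstar i j)| ≤ δ₁)
    (h3 : ∑ i, ∑ j, (P i j - Pstar i j) ^ 2 ≤ δ₂ ^ 2)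
    (lam lamstar : Fin (M + N) → ℝ) (hla : Antitone lam) (hlsa : Antitone lamstar)
    (hlc : (Matrix.fromBlocks (Matrix.diagonal (P *ᵥ 1)) P Pᵀ
        (Matrix.diagonal (Pᵀ *ᵥ 1))).charpoly
        = ∏ i, (Polynomial.X - Polynomial.C (lam i)))
    (hlsc : (Matrix.fromBlocks (Matrix.diagonal (Pstar *ᵥ 1)) Pstar Pstarᵀ
        (Matrix.diagonal (Pstarᵀ *ᵥ 1))).charpoly
        = ∏ i, (Polynomial.X - Polynomial.C (lamstar i))) :
    ∀ k : Fin (M + N), |lam k - lamstar k| ≤ δ₁ + δ₂ := by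
  intro k
  obtain ⟨b, hb⟩ := aux_basis (aux_herm P) (by simp) lam hla hlc
  obtain ⟨b', hb'⟩ := aux_basis (aux_herm Pstar) (by simp) lamstar hlsa hlsc
  have w1 := aux_weyl lam lamstar hla hlsa b b' hb hb' _
    (aux_bound P Pstar δ₁ δ₂ hδ₂ h1 h2 h3) k
  have w2 := aux_weyl lamstar lam hlsa hla b' b hb' hb _
    (aux_bound Pstar P δ₁ δ₂ hδ₂
      (fun i => by
        have := h1 i
        rw [← abs_neg, ← Finset.sum_neg_distrib] at this
        simpa only [neg_sub] using this)
      (fun i => by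
        have := h2 i
        rw [← abs_neg, ← Finset.sum_neg_distrib] at this
        simpa only [neg_sub] using this)
      (by simpa only [sub_sq_comm] using h3)) k
  rw [abs_le]
  constructor <;> linarith
end

section
/- Let M, N ≥ 2 and let Π* ∈ ℝ^{M×N} be a positive coupling matrix with uniform marginals, with largest two singular values σ₁ > σ₂. Set Δ = (MN/(M+N))² (σ₁² − σ₂²), and suppose the positive matrix Π̂ ∈ ℝ^{M×N} with entries in (0,1) satisfies max_i |Σ_j Π̂_{ij} − 1/M| ≤ δ, max_j |Σ_i Π̂_{ij} − 1/N| ≤ δ, and Σ_{i,j} (Π̂_{ij} − Π*_{ij})² ≤ δ₂², where δ + δ₂ = t · (MN/(M+N)) (σ₁² − σ₂²) for some t ∈ [0,1). Let λ₁(H) ≥ … ≥ λ_{M+N}(H) denote the descending eigenvalues of a symmetric matrix H, and κ(H(Π̂)) = λ₁(H(Π̂))/λ_{M+N−1}(H(Π̂)). Then (1 − tΔ)/((2 + t)Δ) ≤ κ(H(Π̂)) ≤ (1 + tΔ)/((1 − t)Δ). -/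
open Matrix Polynomial

lemma exists_equiv_of_map {α β γ : Type*} [Fintype α] [Fintype β] [DecidableEq γ]
    (f : α → γ) (g : β → γ)
    (h : Multiset.map f Finset.univ.val = Multiset.map g Finset.univ.val) :
    ∃ e : α ≃ β, ∀ a, g (e a) = f a := by
  have hc : ∀ c, Nonempty ({a // f a = c} ≃ {b // g b = c}) := by
    intro c
    apply Fintype.card_eq.mp
    have := congrArg (Multiset.count c) h
    rw [Multiset.count_map, Multiset.count_map] at this
    rw [Fintype.card_subtype, Fintype.card_subtype, Finset.card_def, Finset.card_def,
      Finset.filter_val, Finset.filter_val]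
    simpa only [eq_comm] using this
  exact ⟨Equiv.ofFiberEquiv fun c => (hc c).some, fun a => Equiv.ofFiberEquiv_map _ a⟩

lemma exists_basis {ι n : Type*} [Fintype ι] [DecidableEq ι] [Fintype n] [DecidableEq n]
    (A : Matrix n n ℝ) (hA : Aᵀ = A) (lam : ι → ℝ)
    (h : A.charpoly = ∏ i, (X - C (lam i))) :
    ∃ v : ι → n → ℝ, (∀ i, A *ᵥ v i = lam i • v i) ∧
      (∀ i j, v i ⬝ᵥ v j = if i = j then 1 else 0) ∧
      (∀ x y : n → ℝ, x ⬝ᵥ y = ∑ i, (v i ⬝ᵥ x) * (v i ⬝ᵥ y)) ∧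
      (∀ x : n → ℝ, x ⬝ᵥ A *ᵥ x = ∑ i, lam i * (v i ⬝ᵥ x) ^ 2) := by
  have hH : A.IsHermitian := by
    rw [Matrix.IsHermitian, conjTranspose_eq_transpose_of_trivial, hA]
  have e1 : Multiset.map lam Finset.univ.val = Multiset.map hH.eigenvalues Finset.univ.val := by
    have h1 := hH.roots_charpoly_eq_eigenvalues
    have h2 : (∏ i, (X - C (lam i))).roots = Multiset.map lam Finset.univ.val := by
      have := roots_multiset_prod_X_sub_C (Multiset.map lam Finset.univ.val)
      rw [Multiset.map_map] at this
      exact this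
    rw [h, h2] at h1
    exact h1
  obtain ⟨e, he⟩ := exists_equiv_of_map _ _ e1
  let b := hH.eigenvectorBasis
  have hv : ∀ i, A *ᵥ (fun k => b (e i) k) = lam i • (fun k => b (e i) k) := by
    intro i
    have := hH.mulVec_eigenvectorBasis (e i)
    rw [he] at this
    exact this
  have hp : ∀ x y : n → ℝ, x ⬝ᵥ y = ∑ i, ((fun k => b (e i) k) ⬝ᵥ x) * ((fun k => b (e i) k) ⬝ᵥ y) := by
    intro x y
    have := b.sum_inner_mul_inner (WithLp.toLp 2 x) (WithLp.toLp 2 y)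
    rw [← e.sum_comp] at this
    simp only [EuclideanSpace.inner_eq_star_dotProduct, star_trivial] at this
    rw [dotProduct_comm, ← this]
    refine Finset.sum_congr rfl fun i _ => ?_
    congr 1
    exact dotProduct_comm _ _
  refine ⟨fun i k => b (e i) k, hv, ?_, hp, ?_⟩
  · intro i j
    have := orthonormal_iff_ite.mp b.orthonormal (e i) (e j)
    simp only [EuclideanSpace.inner_eq_star_dotProduct, star_trivial, e.injective.eq_iff] at this
    rw [dotProduct_comm]
    exact this
  · intro x
    rw [hp]
    refine Finset.sum_congr rfl fun i _ => ?_
    have : (fun k => b (e i) k) ⬝ᵥ A *ᵥ x = lam i * ((fun k => b (e i) k) ⬝ᵥ x) := by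
      rw [dotProduct_mulVec, ← mulVec_transpose, hA, hv, smul_dotProduct, smul_eq_mul]
    rw [this]; ring

lemma weyl_tools {n : Type*} [Fintype n] [DecidableEq n] (K : ℕ) (hK : 2 ≤ K)
    (A : Matrix n n ℝ) (hA : Aᵀ = A) (lam : Fin K → ℝ) (hl : Antitone lam)
    (k0 k2 k1 : Fin K) (hk0 : k0.val = 0) (hk2 : k2.val = K - 2) (hk1 : k1.val = K - 1)
    (h : A.charpoly = ∏ i, (X - C (lam i))) :
    (∃ z : n → ℝ, z ⬝ᵥ z = 1 ∧ z ⬝ᵥ A *ᵥ z = lam k0) ∧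
    (∀ z : n → ℝ, z ⬝ᵥ A *ᵥ z ≤ lam k0 * (z ⬝ᵥ z)) ∧
    (∀ z0 : n → ℝ, ∃ z : n → ℝ, z ⬝ᵥ z0 = 0 ∧ 0 < z ⬝ᵥ z ∧
      z ⬝ᵥ A *ᵥ z ≤ lam k2 * (z ⬝ᵥ z)) ∧
    (∀ z0 w : n → ℝ, z0 ⬝ᵥ w = 0 → 0 < z0 ⬝ᵥ z0 → 0 < w ⬝ᵥ w →
      ∃ a b : ℝ, 0 < (a • z0 + b • w) ⬝ᵥ (a • z0 + b • w) ∧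
      lam k2 * ((a • z0 + b • w) ⬝ᵥ (a • z0 + b • w)) ≤
        (a • z0 + b • w) ⬝ᵥ A *ᵥ (a • z0 + b • w)) := by
  obtain ⟨v, hv, ho, hp, hq⟩ := exists_basis A hA lam h
  refine ⟨⟨v k0, by simp [ho], by simp [hv, ho]⟩, ?_, ?_, ?_⟩
  · intro z
    rw [hq, hp z z, Finset.mul_sum]
    refine Finset.sum_le_sum fun i _ => ?_
    have : lam i ≤ lam k0 := hl (by rw [Fin.le_def]; omega)
    nlinarith [sq_nonneg (v i ⬝ᵥ z)]
  · intro z0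
    set p := v k2 with hpdef
    set r := v k1 with hrdef
    have hpp : p ⬝ᵥ p = 1 := by simp [hpdef, ho]
    have hrr : r ⬝ᵥ r = 1 := by simp [hrdef, ho]
    have hpr : p ⬝ᵥ r = 0 := by
      rw [hpdef, hrdef, ho, if_neg]; intro h; rw [h] at hk2; omega
    have hrp : r ⬝ᵥ p = 0 := by rw [dotProduct_comm, hpr]
    have hAp : A *ᵥ p = lam k2 • p := hv _
    have hAr : A *ᵥ r = lam k1 • r := hv _
    have hle : lam k1 ≤ lam k2 :=
      hl (by rw [Fin.le_def]; omega)
    by_cases hz : p ⬝ᵥ z0 = 0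
    · refine ⟨p, hz, by rw [hpp]; norm_num, ?_⟩
      rw [hAp, dotProduct_smul, smul_eq_mul]
    · refine ⟨(r ⬝ᵥ z0) • p - (p ⬝ᵥ z0) • r, ?_, ?_, ?_⟩
      · simp only [sub_dotProduct, smul_dotProduct, smul_eq_mul]; ring
      · simp only [sub_dotProduct, dotProduct_sub, dotProduct_smul, smul_dotProduct, smul_eq_mul,
          hpp, hrr, hpr, hrp]
        have : 0 < (p ⬝ᵥ z0) ^ 2 := by positivity
        nlinarith [sq_nonneg (r ⬝ᵥ z0)]
      · simp only [mulVec_sub, mulVec_smul, hAp, hAr, sub_dotProduct, dotProduct_sub,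
          dotProduct_smul, smul_dotProduct, smul_eq_mul, hpp, hrr, hpr, hrp]
        nlinarith [sq_nonneg (p ⬝ᵥ z0)]
  · intro z0 w hzw hz hw
    set r := v k1 with hrdef
    have key : ∀ z : n → ℝ, r ⬝ᵥ z = 0 →
        lam k2 * (z ⬝ᵥ z) ≤ z ⬝ᵥ A *ᵥ z := by
      intro z hrz
      rw [hq, hp z z, Finset.mul_sum]
      refine Finset.sum_le_sum fun i _ => ?_
      by_cases hi : i = k1
      · rw [hi, ← hrdef, hrz]; simp
      · have : lam k2 ≤ lam i := hl (by
          have := i.2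
          have : i.val ≠ K - 1 := fun h => hi (Fin.ext (h.trans hk1.symm))
          rw [Fin.le_def]; omega)
        nlinarith [sq_nonneg (v i ⬝ᵥ z)]
    have hwz : w ⬝ᵥ z0 = 0 := by rw [dotProduct_comm, hzw]
    by_cases hr : r ⬝ᵥ z0 = 0
    · refine ⟨1, 0, by simpa using hz, key _ ?_⟩
      simp [hr]
    · refine ⟨r ⬝ᵥ w, -(r ⬝ᵥ z0), ?_, key _ ?_⟩
      · simp only [add_dotProduct, dotProduct_add, dotProduct_smul, smul_dotProduct, smul_eq_mul,
          hzw, hwz]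
        have : 0 < (r ⬝ᵥ z0) ^ 2 := by positivity
        nlinarith [mul_nonneg (sq_nonneg (r ⬝ᵥ w)) hz.le, mul_pos this hw]
      · simp only [dotProduct_add, dotProduct_smul, smul_eq_mul]; ring

lemma spec_tools (M N : ℕ) (hM : 2 ≤ M) (hN : 2 ≤ N)
    (P : Matrix (Fin M) (Fin N) ℝ)
    (hpos : ∀ i j, 0 < P i j)
    (hrow : ∀ i, ∑ j, P i j = 1 / (M : ℝ))
    (hcol : ∀ j, ∑ i, P i j = 1 / (N : ℝ))
    (σ : Fin M → ℝ) (i0 i1 : Fin M) (hi0 : i0.val = 0) (hi1 : i1.val = 1) (hσa : Antitone σ) (hσ0 : ∀ i, 0 ≤ σ i)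
    (hσchar : (P * Pᵀ).charpoly = ∏ i, (X - C (σ i ^ 2)))
    (hσgap : σ i1 < σ i0) :
    σ i0 ^ 2 = 1 / ((M : ℝ) * N) ∧
    (∀ x : Fin M → ℝ, ∑ i, x i = 0 →
      ∑ j, (∑ i, P i j * x i) ^ 2 ≤ σ i1 ^ 2 * ∑ i, x i ^ 2) ∧
    (∃ u : Fin M → ℝ, ∑ i, u i = 0 ∧ ∑ i, u i ^ 2 = 1 ∧
      ∑ j, (∑ i, P i j * u i) ^ 2 = σ i1 ^ 2) := by
  have hM0 : (0 : ℝ) < M := by positivity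
  have hN0 : (0 : ℝ) < N := by positivity
  obtain ⟨v, hv, ho, hp, hq⟩ := exists_basis (P * Pᵀ) (by simp) _ hσchar
  have hform : ∀ x : Fin M → ℝ, x ⬝ᵥ (P * Pᵀ) *ᵥ x = ∑ j, (∑ i, P i j * x i) ^ 2 := by
    intro x
    rw [← mulVec_mulVec, dotProduct_mulVec, ← mulVec_transpose]
    simp only [dotProduct, mulVec, transpose_apply, sq]
  have hdd : ∀ x : Fin M → ℝ, x ⬝ᵥ x = ∑ i, x i ^ 2 := by
    intro x; simp only [dotProduct, sq]
  have hup : ∀ x : Fin M → ℝ, ∑ j, (∑ i, P i j * x i) ^ 2 ≤ 1 / ((M : ℝ) * N) * ∑ i, x i ^ 2 := by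
    intro x
    have h1 : ∀ j, (∑ i, P i j * x i) ^ 2 ≤ 1 / (N : ℝ) * ∑ i, P i j * x i ^ 2 := by
      intro j
      rw [← hcol j]
      apply Finset.sum_sq_le_sum_mul_sum_of_sq_le_mul
      · intro i _; exact (hpos i j).le
      · intro i _; have := hpos i j; positivity
      · intro i _; apply le_of_eq; ring
    refine (Finset.sum_le_sum fun j _ => h1 j).trans ?_
    rw [← Finset.mul_sum, Finset.sum_comm]
    simp only [← Finset.sum_mul, hrow]
    rw [← Finset.mul_sum]
    apply le_of_eq
    field_simp
  have hone : (P * Pᵀ) *ᵥ (1 : Fin M → ℝ) = (1 / ((M : ℝ) * N)) • (1 : Fin M → ℝ) := by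
    rw [← mulVec_mulVec]
    ext i
    simp only [mulVec, dotProduct, transpose_apply, Pi.one_apply, mul_one, hcol, Pi.smul_apply,
      smul_eq_mul]
    rw [← Finset.sum_mul, hrow]; field_simp
  have hle0 : σ i0 ^ 2 ≤ 1 / ((M : ℝ) * N) := by
    have h1 := hup (v i0)
    rw [← hform, hv, ← hdd, dotProduct_smul, ho] at h1
    simpa using h1
  have hvone : ∀ i, (σ i ^ 2 - 1 / ((M : ℝ) * N)) * (v i ⬝ᵥ 1) = 0 := by
    intro i
    have h1 : v i ⬝ᵥ (P * Pᵀ) *ᵥ (1 : Fin M → ℝ) = σ i ^ 2 * (v i ⬝ᵥ 1) := by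
      rw [dotProduct_mulVec, ← mulVec_transpose, transpose_mul, transpose_transpose, hv,
        smul_dotProduct, smul_eq_mul]
    rw [hone, dotProduct_smul, smul_eq_mul] at h1
    linarith
  have hlt : ∀ i, i ≠ i0 → σ i ^ 2 ≤ σ i1 ^ 2 := by
    intro i hi
    have : i1 ≤ i := by
      have : i.val ≠ 0 := fun h => hi (Fin.ext (h.trans hi0.symm))
      rw [Fin.le_def]; omega
    exact pow_le_pow_left₀ (hσ0 i) (hσa this) 2
  have hlt1 : σ i1 ^ 2 < σ i0 ^ 2 := pow_lt_pow_left₀ hσgap (hσ0 _) (by norm_num)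
  have hvz : ∀ i, i ≠ i0 → v i ⬝ᵥ 1 = 0 := by
    intro i hi
    rcases mul_eq_zero.mp (hvone i) with h | h
    · have := hlt i hi
      linarith
    · exact h
  have hdot : ∀ x : Fin M → ℝ, ∑ i, x i = (v i0 ⬝ᵥ x) * (v i0 ⬝ᵥ 1) := by
    intro x
    have h1 := hp x 1
    rw [Finset.sum_eq_single i0 (fun i _ hi => by rw [hvz i hi, mul_zero]) (by simp)] at h1
    rw [← h1, dotProduct_one]
  have hne : v i0 ⬝ᵥ 1 ≠ 0 := by
    intro h
    have := hdot 1
    rw [h] at this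
    simp at this
    omega
  refine ⟨?_, ?_, v i1, ?_, ?_, ?_⟩
  · rcases mul_eq_zero.mp (hvone i0) with h | h
    · linarith
    · exact absurd h hne
  · intro x hx
    have hx0 : v i0 ⬝ᵥ x = 0 := by
      rw [hdot] at hx
      exact (mul_eq_zero.mp hx).resolve_right hne
    rw [← hform, ← hdd, hq, hp x x, Finset.mul_sum]
    refine Finset.sum_le_sum fun i _ => ?_
    by_cases hi : i = i0
    · rw [hi, hx0]; simp
    · nlinarith [sq_nonneg (v i ⬝ᵥ x), hlt i hi]
  · rw [← dotProduct_one]; exact hvz _ (by intro h; rw [h] at hi1; omega)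
  · rw [← hdd, ho]; simp
  · rw [← hform, hv, dotProduct_smul, ho]; simp

lemma q_expand {M N : ℕ} (P : Matrix (Fin M) (Fin N) ℝ) (x : Fin M → ℝ) (y : Fin N → ℝ) :
    ∑ i, ∑ j, P i j * (x i + y j) ^ 2 =
      ∑ i, (∑ j, P i j) * x i ^ 2 + ∑ j, (∑ i, P i j) * y j ^ 2
        + 2 * ∑ j, (∑ i, P i j * x i) * y j := by
  have e2 : ∑ j, (∑ i, P i j) * y j ^ 2 = ∑ i, ∑ j, P i j * y j ^ 2 := by
    rw [Finset.sum_comm]; simp only [Finset.sum_mul]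
  have e3 : ∑ j, (∑ i, P i j * x i) * y j = ∑ i, ∑ j, P i j * x i * y j := by
    rw [Finset.sum_comm]; simp only [Finset.sum_mul]
  rw [e2, e3]
  simp only [Finset.sum_mul, Finset.mul_sum]
  rw [← Finset.sum_add_distrib, ← Finset.sum_add_distrib]
  refine Finset.sum_congr rfl fun i _ => ?_
  rw [← Finset.sum_add_distrib, ← Finset.sum_add_distrib]
  refine Finset.sum_congr rfl fun j _ => ?_
  ring

lemma q_link {M N : ℕ} (P : Matrix (Fin M) (Fin N) ℝ) (z : Fin M ⊕ Fin N → ℝ) :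
    z ⬝ᵥ (Matrix.fromBlocks (Matrix.diagonal (P *ᵥ 1)) P Pᵀ
        (Matrix.diagonal (Pᵀ *ᵥ 1))) *ᵥ z =
      ∑ i, ∑ j, P i j * (z (Sum.inl i) + z (Sum.inr j)) ^ 2 := by
  rw [q_expand, fromBlocks_mulVec]
  simp only [dotProduct, Fintype.sum_sum_type, Sum.elim_inl, Sum.elim_inr, Pi.add_apply,
    mulVec_diagonal, Function.comp]
  simp only [mulVec, dotProduct, transpose_apply, Pi.one_apply, mul_one, Function.comp]
  have e3 : ∑ i, z (Sum.inl i) * ∑ j, P i j * z (Sum.inr j) =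
      ∑ j, (∑ i, P i j * z (Sum.inl i)) * z (Sum.inr j) := by
    simp only [Finset.mul_sum, Finset.sum_mul]
    rw [Finset.sum_comm]
    refine Finset.sum_congr rfl fun i _ => Finset.sum_congr rfl fun j _ => ?_
    ring
  simp only [mul_add, Finset.sum_add_distrib, e3]
  have e4 : ∑ j, z (Sum.inr j) * ∑ i, P i j * z (Sum.inl i) =
      ∑ j, (∑ i, P i j * z (Sum.inl i)) * z (Sum.inr j) :=
    Finset.sum_congr rfl fun j _ => mul_comm _ _
  have e5 : ∑ i, z (Sum.inl i) * ((∑ j, P i j) * z (Sum.inl i)) =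
      ∑ i, (∑ j, P i j) * z (Sum.inl i) ^ 2 := Finset.sum_congr rfl fun j _ => by ring
  have e6 : ∑ j, z (Sum.inr j) * ((∑ i, P i j) * z (Sum.inr j)) =
      ∑ j, (∑ i, P i j) * z (Sum.inr j) ^ 2 := Finset.sum_congr rfl fun j _ => by ring
  rw [e4, e5, e6]; ring

lemma cross_bound {M N : ℕ} (E : Matrix (Fin M) (Fin N) ℝ) (d : ℝ) (hd : 0 ≤ d)
    (h : ∑ i, ∑ j, E i j ^ 2 ≤ d ^ 2) (x : Fin M → ℝ) (y : Fin N → ℝ) :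
    |2 * ∑ j, (∑ i, E i j * x i) * y j| ≤ d * (∑ i, x i ^ 2 + ∑ j, y j ^ 2) := by
  have hx : 0 ≤ ∑ i, x i ^ 2 := Finset.sum_nonneg fun i _ => sq_nonneg _
  have hy : 0 ≤ ∑ j, y j ^ 2 := Finset.sum_nonneg fun i _ => sq_nonneg _
  have h1 := Finset.sum_mul_sq_le_sq_mul_sq Finset.univ (fun j => ∑ i, E i j * x i) y
  have h2 : ∑ j, (∑ i, E i j * x i) ^ 2 ≤ d ^ 2 * ∑ i, x i ^ 2 := by
    calc ∑ j, (∑ i, E i j * x i) ^ 2 ≤ ∑ j, (∑ i, E i j ^ 2) * ∑ i, x i ^ 2 :=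
          Finset.sum_le_sum fun j _ => Finset.sum_mul_sq_le_sq_mul_sq _ _ _
      _ = (∑ i, ∑ j, E i j ^ 2) * ∑ i, x i ^ 2 := by rw [← Finset.sum_mul, Finset.sum_comm]
      _ ≤ _ := mul_le_mul_of_nonneg_right h hx
  apply abs_le_of_sq_le_sq _ (by positivity)
  set S := ∑ j, (∑ i, E i j * x i) * y j
  have h4 := mul_le_mul_of_nonneg_right h2 hy
  have h5 : 0 ≤ d ^ 2 * (∑ i, x i ^ 2 - ∑ j, y j ^ 2) ^ 2 := by positivity
  nlinarith

lemma pert (M N : ℕ) (P Q : Matrix (Fin M) (Fin N) ℝ) (δ d : ℝ) (hd : 0 ≤ d)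
    (hrow : ∀ i, ∑ j, P i j = 1 / (M : ℝ))
    (hcol : ∀ j, ∑ i, P i j = 1 / (N : ℝ))
    (h1 : ∀ i, |(∑ j, Q i j) - 1 / (M : ℝ)| ≤ δ)
    (h2 : ∀ j, |(∑ i, Q i j) - 1 / (N : ℝ)| ≤ δ)
    (h3 : ∑ i, ∑ j, (Q i j - P i j) ^ 2 ≤ d ^ 2) (x : Fin M → ℝ) (y : Fin N → ℝ) :
    |∑ i, ∑ j, Q i j * (x i + y j) ^ 2 - ∑ i, ∑ j, P i j * (x i + y j) ^ 2| ≤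
      (δ + d) * (∑ i, x i ^ 2 + ∑ j, y j ^ 2) := by
  have e := q_expand (Q - P) x y
  have e0 : ∑ i, ∑ j, (Q - P) i j * (x i + y j) ^ 2 =
      ∑ i, ∑ j, Q i j * (x i + y j) ^ 2 - ∑ i, ∑ j, P i j * (x i + y j) ^ 2 := by
    simp only [Matrix.sub_apply, sub_mul, Finset.sum_sub_distrib]
  rw [← e0, e]
  have c := cross_bound (Q - P) d hd (by simpa only [Matrix.sub_apply] using h3) x y
  have a1 : |∑ i, (∑ j, (Q - P) i j) * x i ^ 2| ≤ δ * ∑ i, x i ^ 2 := by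
    rw [Finset.mul_sum]
    refine (Finset.abs_sum_le_sum_abs _ _).trans (Finset.sum_le_sum fun i _ => ?_)
    rw [abs_mul, abs_of_nonneg (sq_nonneg (x i))]
    refine mul_le_mul_of_nonneg_right ?_ (sq_nonneg _)
    simp only [Matrix.sub_apply, Finset.sum_sub_distrib, hrow]
    exact h1 i
  have a2 : |∑ j, (∑ i, (Q - P) i j) * y j ^ 2| ≤ δ * ∑ j, y j ^ 2 := by
    rw [Finset.mul_sum]
    refine (Finset.abs_sum_le_sum_abs _ _).trans (Finset.sum_le_sum fun i _ => ?_)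
    rw [abs_mul, abs_of_nonneg (sq_nonneg (y i))]
    refine mul_le_mul_of_nonneg_right ?_ (sq_nonneg _)
    simp only [Matrix.sub_apply, Finset.sum_sub_distrib, hcol]
    exact h2 i
  refine (abs_add_three _ _ _).trans ?_
  linarith

lemma scalar_low (m n s X Y C : ℝ) (hm : 0 < m) (hn : 0 < n) (hX : 0 ≤ X) (hY : 0 ≤ Y)
    (hC : C ^ 2 ≤ s ^ 2 * X * Y) :
    (m * n - s ^ 2) / (m + n) * (X + Y) ≤ m * X + n * Y + 2 * C := by
  set g := (m * n - s ^ 2) / (m + n) with hg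
  have hc : g * (m + n) = m * n - s ^ 2 := by rw [hg]; field_simp
  have hA : 0 ≤ m - g := by
    have : m - g = (m ^ 2 + s ^ 2) / (m + n) := by rw [hg]; field_simp; ring
    rw [this]; positivity
  have hB : 0 ≤ n - g := by
    have : n - g = (n ^ 2 + s ^ 2) / (m + n) := by rw [hg]; field_simp; ring
    rw [this]; positivity
  have hAB : s ^ 2 ≤ (m - g) * (n - g) := by nlinarith [sq_nonneg g]
  have h1 : |2 * C| ≤ (m - g) * X + (n - g) * Y := by
    apply abs_le_of_sq_le_sq _ (by positivity)
    have h2 := mul_le_mul_of_nonneg_right hAB (mul_nonneg hX hY)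
    nlinarith [sq_nonneg ((m - g) * X - (n - g) * Y)]
  have := (abs_le.mp h1).1
  linarith

lemma star_top (M N : ℕ) (hM : 2 ≤ M) (hN : 2 ≤ N)
    (P : Matrix (Fin M) (Fin N) ℝ)
    (hpos : ∀ i j, 0 < P i j)
    (hrow : ∀ i, ∑ j, P i j = 1 / (M : ℝ))
    (hcol : ∀ j, ∑ i, P i j = 1 / (N : ℝ)) (x : Fin M → ℝ) (y : Fin N → ℝ) :
    ∑ i, ∑ j, P i j * (x i + y j) ^ 2 ≤
      (1 / (M : ℝ) + 1 / N) * (∑ i, x i ^ 2 + ∑ j, y j ^ 2) := by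
  have hM0 : (0 : ℝ) < M := by positivity
  have hN0 : (0 : ℝ) < N := by positivity
  have h1 : ∀ i j, P i j * (x i + y j) ^ 2 ≤
      P i j * ((1 + (M : ℝ) / N) * x i ^ 2) + P i j * ((1 + (N : ℝ) / M) * y j ^ 2) := by
    intro i j
    rw [← mul_add]
    refine mul_le_mul_of_nonneg_left ?_ (hpos i j).le
    have : (1 + (M : ℝ) / N) * x i ^ 2 + (1 + (N : ℝ) / M) * y j ^ 2 - (x i + y j) ^ 2 =
      (M * x i - N * y j) ^ 2 / (M * N) := by field_simp; ring
    have h2 : 0 ≤ (M * x i - N * y j) ^ 2 / ((M : ℝ) * N) := by positivity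
    linarith
  refine (Finset.sum_le_sum fun i _ => Finset.sum_le_sum fun j _ => h1 i j).trans ?_
  simp only [Finset.sum_add_distrib]
  rw [Finset.sum_comm (f := fun i j => P i j * ((1 + (N : ℝ) / M) * y j ^ 2))]
  simp only [← Finset.sum_mul, hrow, hcol]
  simp only [← Finset.mul_sum]
  apply le_of_eq
  field_simp
  ring

lemma star_low (M N : ℕ) (hM : 2 ≤ M) (hN : 2 ≤ N)
    (P : Matrix (Fin M) (Fin N) ℝ)
    (hrow : ∀ i, ∑ j, P i j = 1 / (M : ℝ))
    (hcol : ∀ j, ∑ i, P i j = 1 / (N : ℝ)) (s : ℝ)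
    (hs : ∀ x : Fin M → ℝ, ∑ i, x i = 0 →
      ∑ j, (∑ i, P i j * x i) ^ 2 ≤ s ^ 2 * ∑ i, x i ^ 2)
    (x : Fin M → ℝ) (y : Fin N → ℝ) (hxy : ∑ i, x i = ∑ j, y j) :
    (1 / (M : ℝ) * (1 / N) - s ^ 2) / (1 / (M : ℝ) + 1 / N) * (∑ i, x i ^ 2 + ∑ j, y j ^ 2) ≤
      ∑ i, ∑ j, P i j * (x i + y j) ^ 2 := by
  have hM0 : (0 : ℝ) < M := by positivity
  have hN0 : (0 : ℝ) < N := by positivity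
  set k := ∑ i, x i with hk
  set x' : Fin M → ℝ := fun i => x i - k / M with hx'
  set y' : Fin N → ℝ := fun j => y j - k / N with hy'
  have sx : ∑ i, x' i = 0 := by
    simp only [hx', Finset.sum_sub_distrib, ← hk]; simp; field_simp; ring
  have sy : ∑ i, y' i = 0 := by
    simp only [hy', Finset.sum_sub_distrib, ← hxy]; simp; field_simp; ring
  have eX : ∑ i, x i ^ 2 = ∑ i, x' i ^ 2 + k ^ 2 / M := by
    have : ∀ i, x i ^ 2 = x' i ^ 2 + 2 * (k / M) * x' i + (k / M) ^ 2 := by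
      intro i; simp only [hx']; ring
    simp only [this, Finset.sum_add_distrib, ← Finset.mul_sum, sx]
    simp; field_simp
  have eY : ∑ i, y i ^ 2 = ∑ i, y' i ^ 2 + k ^ 2 / N := by
    have : ∀ i, y i ^ 2 = y' i ^ 2 + 2 * (k / N) * y' i + (k / N) ^ 2 := by
      intro i; simp only [hy']; ring
    simp only [this, Finset.sum_add_distrib, ← Finset.mul_sum, sy]
    simp; field_simp
  have eC : ∑ j, (∑ i, P i j * x i) * y j =
      ∑ j, (∑ i, P i j * x' i) * y' j + k ^ 2 / (M * N) := by
    have a1 : ∀ j, ∑ i, P i j * x i = ∑ i, P i j * x' i + k / (M * N) := by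
      intro j
      have : ∀ i, P i j * x i = P i j * x' i + P i j * (k / M) := by
        intro i; simp only [hx']; ring
      simp only [this, Finset.sum_add_distrib, ← Finset.sum_mul, hcol]
      field_simp
    have a2 : ∑ j, ∑ i, P i j * x' i = 0 := by
      rw [Finset.sum_comm]
      simp only [← Finset.sum_mul, hrow]
      rw [← Finset.mul_sum, sx, mul_zero]
    have a3 : ∀ j, (∑ i, P i j * x i) * y j = (∑ i, P i j * x' i) * y' j +
        (∑ i, P i j * x' i) * (k / N) + k / (M * N) * y j := by
      intro j; rw [a1]; simp only [hy']; ring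
    simp only [a3, Finset.sum_add_distrib]
    rw [← Finset.sum_mul, a2, ← Finset.mul_sum, ← hxy]
    field_simp; ring
  have hC : (∑ j, (∑ i, P i j * x' i) * y' j) ^ 2 ≤
      s ^ 2 * (∑ i, x' i ^ 2) * ∑ j, y' j ^ 2 :=
    (Finset.sum_mul_sq_le_sq_mul_sq _ _ _).trans
      (mul_le_mul_of_nonneg_right (hs x' sx) (Finset.sum_nonneg fun i _ => sq_nonneg _))
  have key := scalar_low (1 / M) (1 / N) s _ _ _ (by positivity) (by positivity)
    (Finset.sum_nonneg fun i _ => sq_nonneg _) (Finset.sum_nonneg fun i _ => sq_nonneg _) hC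
  rw [q_expand]
  simp only [hrow, hcol, ← Finset.mul_sum]
  rw [eX, eY, eC]
  have h5 : (1 / (M : ℝ) * (1 / N) - s ^ 2) / (1 / (M : ℝ) + 1 / N) * (k ^ 2 / M + k ^ 2 / N) =
      k ^ 2 * (1 / (M : ℝ) * (1 / N) - s ^ 2) := by field_simp
  have h6 : k ^ 2 * (1 / (M : ℝ) * (1 / N) - s ^ 2) ≤
      1 / M * (k ^ 2 / M) + 1 / N * (k ^ 2 / N) + 2 * (k ^ 2 / (M * N)) := by
    have : 1 / M * (k ^ 2 / M) + 1 / N * (k ^ 2 / N) + 2 * (k ^ 2 / (M * N)) -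
      k ^ 2 * (1 / (M : ℝ) * (1 / N) - s ^ 2) =
      k ^ 2 * ((1 / M) ^ 2 + (1 / N) ^ 2 + s ^ 2 + 1 / (M * N)) := by field_simp; ring
    have h7 : 0 ≤ k ^ 2 * ((1 / (M : ℝ)) ^ 2 + (1 / N) ^ 2 + s ^ 2 + 1 / (M * N)) := by positivity
    linarith
  linarith

lemma star_test (M N : ℕ) (hM : 2 ≤ M) (hN : 2 ≤ N)
    (P : Matrix (Fin M) (Fin N) ℝ)
    (hrow : ∀ i, ∑ j, P i j = 1 / (M : ℝ))
    (hcol : ∀ j, ∑ i, P i j = 1 / (N : ℝ)) (s : ℝ)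
    (hs : ∀ x : Fin M → ℝ, ∑ i, x i = 0 →
      ∑ j, (∑ i, P i j * x i) ^ 2 ≤ s ^ 2 * ∑ i, x i ^ 2)
    (u : Fin M → ℝ) (hu0 : ∑ i, u i = 0) (hu1 : ∑ i, u i ^ 2 = 1)
    (hus : ∑ j, (∑ i, P i j * u i) ^ 2 = s ^ 2)
    (hgap : 0 < 1 / (M : ℝ) * (1 / N) - s ^ 2) :
    ∃ (x : Fin M → ℝ) (y : Fin N → ℝ), ∑ i, x i = ∑ j, y j ∧
      0 < ∑ i, x i ^ 2 + ∑ j, y j ^ 2 ∧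
      ∑ i, ∑ j, P i j * (x i + y j) ^ 2 ≤
       2 * ((1 / (M : ℝ) * (1 / N) - s ^ 2) / (1 / (M : ℝ) + 1 / N)) *
        (∑ i, x i ^ 2 + ∑ j, y j ^ 2) := by
  have hM0 : (0 : ℝ) < M := by positivity
  have hN0 : (0 : ℝ) < N := by positivity
  by_cases h0 : s = 0
  · subst h0
    rcases le_total N M with hNM | hMN
    · refine ⟨u, 0, by simp [hu0], by simp [hu1], ?_⟩
      rw [q_expand]
      simp only [hrow, hcol, ← Finset.mul_sum, hu1]
      simp
      have : (N : ℝ) ≤ M := by exact_mod_cast hNM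
      have e : 2 * ((M : ℝ)⁻¹ * (N : ℝ)⁻¹ / ((M : ℝ)⁻¹ + (N : ℝ)⁻¹)) = 2 / (M + N) := by
        field_simp; ring
      rw [e, inv_eq_one_div, div_le_div_iff₀ (by positivity) (by positivity)]
      linarith
    · let j0 : Fin N := ⟨0, by omega⟩
      let j1 : Fin N := ⟨1, by omega⟩
      have hj : j0 ≠ j1 := by simp [j0, j1]
      set y : Fin N → ℝ := fun j => (if j = j0 then 1 else 0) - (if j = j1 then 1 else 0) with hy
      have sy : ∑ j, y j = 0 := by simp [hy]
      have hYpos : 0 < ∑ j, y j ^ 2 := by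
        apply Finset.sum_pos' (fun i _ => sq_nonneg _)
        exact ⟨j0, Finset.mem_univ _, by simp [hy, hj]⟩
      refine ⟨0, y, by simp [sy], by simpa using hYpos, ?_⟩
      rw [q_expand]
      simp only [hrow, hcol, ← Finset.mul_sum]
      simp
      have : (M : ℝ) ≤ N := by exact_mod_cast hMN
      have e : 2 * ((M : ℝ)⁻¹ * (N : ℝ)⁻¹ / ((M : ℝ)⁻¹ + (N : ℝ)⁻¹)) = 2 / (M + N) := by
        field_simp; ring
      rw [e]
      refine mul_le_mul_of_nonneg_right ?_ hYpos.le
      rw [inv_eq_one_div, div_le_div_iff₀ (by positivity) (by positivity)]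
      linarith
  · set p : Fin N → ℝ := fun j => ∑ i, P i j * u i with hp
    have sp : ∑ j, p j = 0 := by
      simp only [hp]
      rw [Finset.sum_comm]
      simp only [← Finset.sum_mul, hrow]
      rw [← Finset.mul_sum, hu0, mul_zero]
    set m := 1 / (M : ℝ) with hm
    set n := 1 / (N : ℝ) with hn
    have hm0 : 0 < m := by positivity
    have hn0 : 0 < n := by positivity
    set r := √((m - n) ^ 2 + 4 * s ^ 2) with hr
    have hr2 : r ^ 2 = (m - n) ^ 2 + 4 * s ^ 2 := Real.sq_sqrt (by positivity)
    have hr0 : 0 ≤ r := Real.sqrt_nonneg _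
    have hrc : r < m + n := by
      apply lt_of_pow_lt_pow_left₀ 2 (by positivity)
      nlinarith
    set g := (m + n - r) / 2 with hg
    have hgg : g * (m + n - g) = m * n - s ^ 2 := by rw [hg]; nlinarith
    have hg0 : 0 < g := by rw [hg]; linarith
    have hgle : g ≤ 2 * ((m * n - s ^ 2) / (m + n)) := by
      rw [← mul_div_assoc, le_div_iff₀ (by positivity), ← hgg]
      have : g ≤ (m + n) / 2 := by rw [hg]; linarith
      nlinarith
    have hs2 : 0 < s ^ 2 := by positivity
    have X : ∑ i, ((g - n) • u) i ^ 2 = (g - n) ^ 2 := by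
      simp only [Pi.smul_apply, smul_eq_mul, mul_pow, ← Finset.mul_sum, hu1, mul_one]
    have Y : ∑ j, p j ^ 2 = s ^ 2 := hus
    have Cc : ∑ j, (∑ i, P i j * ((g - n) • u) i) * p j = (g - n) * s ^ 2 := by
      rw [← Y, Finset.mul_sum]
      refine Finset.sum_congr rfl fun j _ => ?_
      have : ∑ i, P i j * ((g - n) • u) i = (g - n) * p j := by
        simp only [hp, Finset.mul_sum, Pi.smul_apply, smul_eq_mul]
        exact Finset.sum_congr rfl fun i _ => by ring
      rw [this]; ring
    refine ⟨(g - n) • u, p, ?_, ?_, ?_⟩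
    · simp only [Pi.smul_apply, smul_eq_mul, ← Finset.mul_sum, hu0, sp, mul_zero]
    · rw [X, Y]; positivity
    · rw [q_expand]
      simp only [hrow, hcol]
      rw [← Finset.mul_sum, ← Finset.mul_sum, X, Y, Cc]
      refine le_trans (le_of_eq ?_) (mul_le_mul_of_nonneg_right hgle (by positivity))
      have : s ^ 2 = m * n - g * (m + n - g) := by linarith
      rw [this]; ring

/-- Condition number of the H-matrix of an early-stopped Sinkhorn coupling `Phat`
close to the optimal positive coupling `Pstar` with uniform marginals:
`(1 - tΔ)/((2 + t)Δ) ≤ κ(H(Phat)) ≤ (1 + tΔ)/((1 - t)Δ)` where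
`Δ = (MN/(M+N))² (σ₁² - σ₂²)`. -/
theorem stmt18 (M N : ℕ) (hM : 2 ≤ M) (hN : 2 ≤ N)
    (Pstar : Matrix (Fin M) (Fin N) ℝ)
    (hpos : ∀ i j, 0 < Pstar i j)
    (hrow : Pstar *ᵥ 1 = fun _ => 1 / (M : ℝ))
    (hcol : Pstarᵀ *ᵥ 1 = fun _ => 1 / (N : ℝ))
    (σ : Fin M → ℝ) (hσa : Antitone σ) (hσ0 : ∀ i, 0 ≤ σ i)
    (hσchar : (Pstar * Pstarᵀ).charpoly = ∏ i, (Polynomial.X - Polynomial.C (σ i ^ 2)))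
    (hσgap : σ ⟨1, by omega⟩ < σ ⟨0, by omega⟩)
    (Phat : Matrix (Fin M) (Fin N) ℝ)
    (hhat : ∀ i j, 0 < Phat i j ∧ Phat i j < 1)
    (δ δ₂ t : ℝ) (hδ₂ : 0 ≤ δ₂) (ht0 : 0 ≤ t) (ht1 : t < 1)
    (h1 : ∀ i, |(∑ j, Phat i j) - 1 / (M : ℝ)| ≤ δ)
    (h2 : ∀ j, |(∑ i, Phat i j) - 1 / (N : ℝ)| ≤ δ)
    (h3 : ∑ i, ∑ j, (Phat i j - Pstar i j) ^ 2 ≤ δ₂ ^ 2)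
    (hsum : δ + δ₂ = t * ((M : ℝ) * N / ((M : ℝ) + N)) *
      (σ ⟨0, by omega⟩ ^ 2 - σ ⟨1, by omega⟩ ^ 2))
    (lam : Fin (M + N) → ℝ) (hla : Antitone lam)
    (hlc : (Matrix.fromBlocks (Matrix.diagonal (Phat *ᵥ 1)) Phat Phatᵀ
        (Matrix.diagonal (Phatᵀ *ᵥ 1))).charpoly
        = ∏ i, (Polynomial.X - Polynomial.C (lam i))) :
    let Δ : ℝ := ((M : ℝ) * N / ((M : ℝ) + N)) ^ 2 *
      (σ ⟨0, by omega⟩ ^ 2 - σ ⟨1, by omega⟩ ^ 2)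
    let κ := lam ⟨0, by omega⟩ / lam ⟨M + N - 2, by omega⟩
    (1 - t * Δ) / ((2 + t) * Δ) ≤ κ ∧ κ ≤ (1 + t * Δ) / ((1 - t) * Δ) := by

  intro Δ κ
  have hM0 : (0 : ℝ) < M := by positivity
  have hN0 : (0 : ℝ) < N := by positivity
  have hrow' : ∀ i, ∑ j, Pstar i j = 1 / (M : ℝ) := by
    intro i
    have := congrFun hrow i
    simpa only [mulVec, dotProduct, Pi.one_apply, mul_one] using this
  have hcol' : ∀ j, ∑ i, Pstar i j = 1 / (N : ℝ) := by
    intro j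
    have := congrFun hcol j
    simpa only [mulVec, dotProduct, Pi.one_apply, mul_one, transpose_apply] using this
  obtain ⟨hs0, hs1, u, hu0, hu1, hus⟩ :=
    spec_tools M N hM hN Pstar hpos hrow' hcol' σ ⟨0, by omega⟩ ⟨1, by omega⟩ rfl rfl hσa hσ0 hσchar hσgap
  have hgap2 : σ ⟨1, by omega⟩ ^ 2 < σ ⟨0, by omega⟩ ^ 2 :=
    pow_lt_pow_left₀ hσgap (hσ0 _) (by norm_num)
  set s := σ ⟨1, by omega⟩ with hsdef
  set γ := σ ⟨0, by omega⟩ ^ 2 - s ^ 2 with hγ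
  have hγ0 : 0 < γ := by linarith
  have hγ' : 1 / (M : ℝ) * (1 / N) - s ^ 2 = γ := by rw [hγ, hs0]; field_simp
  set c := 1 / (M : ℝ) + 1 / N with hc
  have hc0 : 0 < c := by positivity
  have hkc : (M : ℝ) * N / ((M : ℝ) + N) = 1 / c := by rw [hc]; field_simp; ring
  have hΔ : Δ = γ / c ^ 2 := by
    simp only [Δ]; rw [hkc, ← hsdef, ← hγ]; field_simp
  rw [hkc] at hsum
  have hpert := pert M N Pstar Phat δ δ₂ hδ₂ hrow' hcol' h1 h2 h3
  rw [hsum] at hpert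
  have hlow := star_low M N hM hN Pstar hrow' hcol' s hs1
  obtain ⟨wx, wy, hw0, hw1, hw2⟩ := star_test M N hM hN Pstar hrow' hcol' s hs1 u hu0 hu1 hus
    (by rw [hγ']; exact hγ0)
  rw [hγ'] at hlow hw2
  have htop := star_top M N hM hN Pstar hpos hrow' hcol'
  rw [← hc] at htop
  set H := Matrix.fromBlocks (Matrix.diagonal (Phat *ᵥ 1)) Phat Phatᵀ
        (Matrix.diagonal (Phatᵀ *ᵥ 1)) with hH
  have hHT : Hᵀ = H := by simp [hH, fromBlocks_transpose]
  obtain ⟨⟨v, hv1, hv2⟩, w2, w3, w4⟩ := weyl_tools (M + N) (by omega) H hHT lam hla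
    ⟨0, by omega⟩ ⟨M + N - 2, by omega⟩ ⟨M + N - 1, by omega⟩ rfl rfl rfl hlc
  have hdd : ∀ z : Fin M ⊕ Fin N → ℝ, z ⬝ᵥ z =
      ∑ i, z (Sum.inl i) ^ 2 + ∑ j, z (Sum.inr j) ^ 2 := by
    intro z; simp only [dotProduct, Fintype.sum_sum_type, sq]
  have hlink : ∀ z, z ⬝ᵥ H *ᵥ z = _ := q_link Phat
  set l0 := lam ⟨0, by omega⟩ with hl0
  set L := lam ⟨M + N - 2, by omega⟩ with hL
  set z0 : Fin M ⊕ Fin N → ℝ := Sum.elim (fun _ => 1) (fun _ => -1) with hz0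
  have hz0d : ∀ z : Fin M ⊕ Fin N → ℝ, z ⬝ᵥ z0 = ∑ i, z (Sum.inl i) - ∑ j, z (Sum.inr j) := by
    intro z
    simp [dotProduct, Fintype.sum_sum_type, hz0, sub_eq_add_neg]
  -- upper bound on the top eigenvalue
  have b1 : l0 ≤ c + t * (1 / c) * γ := by
    have p := (abs_le.mp (hpert (fun i => v (Sum.inl i)) (fun j => v (Sum.inr j)))).2
    have q := htop (fun i => v (Sum.inl i)) (fun j => v (Sum.inr j))
    rw [hlink] at hv2
    simp only [← hdd, hv1, mul_one] at p q
    linarith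
  -- lower bound on the top eigenvalue
  have b2 : c - t * (1 / c) * γ ≤ l0 := by
    set z : Fin M ⊕ Fin N → ℝ := Sum.elim (fun _ => (N : ℝ)) (fun _ => (M : ℝ)) with hz
    have p := (abs_le.mp (hpert (fun i => z (Sum.inl i)) (fun j => z (Sum.inr j)))).1
    have q := w2 z
    rw [hlink] at q
    have e : ∑ i, ∑ j, Pstar i j * (z (Sum.inl i) + z (Sum.inr j)) ^ 2 = c * (z ⬝ᵥ z) := by
      rw [hdd]
      simp only [hz, Sum.elim_inl, Sum.elim_inr, ← Finset.sum_mul, hrow']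
      simp [hc]
      field_simp
    have pz : 0 < z ⬝ᵥ z := by
      rw [hdd]; simp only [hz, Sum.elim_inl, Sum.elim_inr]; simp; positivity
    simp only [← hdd] at p
    rw [e] at p
    refine le_of_mul_le_mul_right ?_ pz
    linarith
  -- lower bound on the second smallest eigenvalue
  have b3 : (1 - t) * (γ / c) ≤ L := by
    obtain ⟨z, hzz, pz, q⟩ := w3 z0
    rw [hlink] at q
    rw [hz0d, sub_eq_zero] at hzz
    have p := (abs_le.mp (hpert (fun i => z (Sum.inl i)) (fun j => z (Sum.inr j)))).1
    have r := hlow (fun i => z (Sum.inl i)) (fun j => z (Sum.inr j)) hzz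
    simp only [← hdd] at p r
    refine le_of_mul_le_mul_right ?_ pz
    have : (1 - t) * (γ / c) * (z ⬝ᵥ z) = γ / c * (z ⬝ᵥ z) - t * (1 / c) * γ * (z ⬝ᵥ z) := by ring
    linarith
  -- upper bound on the second smallest eigenvalue
  have b4 : L ≤ (2 + t) * (γ / c) := by
    set w : Fin M ⊕ Fin N → ℝ := Sum.elim wx wy with hw
    have hww : w ⬝ᵥ w = ∑ i, wx i ^ 2 + ∑ j, wy j ^ 2 := by rw [hdd]; rfl
    have hzw : z0 ⬝ᵥ w = 0 := by
      rw [dotProduct_comm, hz0d]; simp only [hw, Sum.elim_inl, Sum.elim_inr]; linarith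
    have hzz : 0 < z0 ⬝ᵥ z0 := by
      rw [hdd]; simp only [hz0, Sum.elim_inl, Sum.elim_inr]; simp; positivity
    obtain ⟨a, b, pz, q⟩ := w4 z0 w hzw hzz (by rw [hww]; exact hw1)
    have hn : (a • z0 + b • w) ⬝ᵥ (a • z0 + b • w) = a ^ 2 * (z0 ⬝ᵥ z0) + b ^ 2 * (w ⬝ᵥ w) := by
      simp only [add_dotProduct, dotProduct_add, dotProduct_smul, smul_dotProduct, smul_eq_mul,
        hzw, dotProduct_comm w z0]
      ring
    set z := a • z0 + b • w with hz
    rw [hlink] at q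
    have p := (abs_le.mp (hpert (fun i => z (Sum.inl i)) (fun j => z (Sum.inr j)))).2
    simp only [← hdd] at p
    have e : ∑ i, ∑ j, Pstar i j * (z (Sum.inl i) + z (Sum.inr j)) ^ 2 =
        b ^ 2 * ∑ i, ∑ j, Pstar i j * (wx i + wy j) ^ 2 := by
      simp only [Finset.mul_sum]
      refine Finset.sum_congr rfl fun i _ => Finset.sum_congr rfl fun j _ => ?_
      simp only [hz, hz0, hw, Pi.add_apply, Pi.smul_apply, Sum.elim_inl, Sum.elim_inr, smul_eq_mul]
      ring
    rw [e] at p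
    rw [← hww] at hw2
    have r := mul_le_mul_of_nonneg_left hw2 (sq_nonneg b)
    have r2 : b ^ 2 * (2 * (γ / c) * (w ⬝ᵥ w)) ≤ 2 * (γ / c) * (z ⬝ᵥ z) := by
      rw [hn]
      have : 0 ≤ 2 * (γ / c) * (a ^ 2 * (z0 ⬝ᵥ z0)) := by positivity
      linarith
    refine le_of_mul_le_mul_right ?_ pz
    have : (2 + t) * (γ / c) * (z ⬝ᵥ z) =
      2 * (γ / c) * (z ⬝ᵥ z) + t * (1 / c) * γ * (z ⬝ᵥ z) := by ring
    linarith
  have h1t : 0 < 1 - t := by linarith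
  have hLpos : 0 < L := lt_of_lt_of_le (by positivity) b3
  have hlL : L ≤ l0 := hla (by rw [Fin.le_def]; simp)
  have hκ : κ = l0 / L := rfl
  rw [hκ, hΔ]
  constructor
  · have e : (1 - t * (γ / c ^ 2)) / ((2 + t) * (γ / c ^ 2)) =
        (c - t * (1 / c) * γ) / ((2 + t) * (γ / c)) := by field_simp
    rw [e]
    exact div_le_div₀ (by linarith) b2 hLpos b4
  · have e : (1 + t * (γ / c ^ 2)) / ((1 - t) * (γ / c ^ 2)) =
        (c + t * (1 / c) * γ) / ((1 - t) * (γ / c)) := by field_simp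
    rw [e]
    exact div_le_div₀ (by linarith [show 0 ≤ t * (1 / c) * γ by positivity]) b1 (by positivity) b3
end
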